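/- arXiv:2002.10503 — 3 statements merged into one kernel-verified Lean document; each statement's English description precedes it below -/
import Mathlib

section
/- Fix n ≥ 2, w ∈ S_n, and k ∈ {1,…,n−1}. The number of occurrences of σ_k in any reduced decomposition of w is at most ValPair_k(w) + 1. -/
/-- The simple reflection `σ_i = (i, i+1)`, acting on `ℕ` (1-indexed positions/values). -/
def simpleRefl (i : ℕ) : Equiv.Perm ℕ := Equiv.swap i (i + 1)

/-- `w` is a permutation of `{1, …, n}`: it fixes every point outside `[1, n]`. -/
def IsPermOf (n : ℕ) (w : Equiv.Perm ℕ) : Prop :=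
  ∀ x : ℕ, x ∉ Finset.Icc 1 n → w x = x

/-- The Coxeter length of `w`: its number of inversions on `{1, …, n}`. -/
def len (n : ℕ) (w : Equiv.Perm ℕ) : ℕ :=
  ((Finset.Icc 1 n ×ˢ Finset.Icc 1 n).filter fun p => p.1 < p.2 ∧ w p.2 < w p.1).card

/-- `L` is a word for `w`: a list of indices in `[1, n-1]` whose associated product of
simple reflections (read left to right) is `w`. -/
def IsWord (n : ℕ) (w : Equiv.Perm ℕ) (L : List ℕ) : Prop :=
  (∀ i ∈ L, 1 ≤ i ∧ i ≤ n - 1) ∧ (L.map simpleRefl).prod = w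

/-- `L` is a reduced decomposition of `w`. -/
def IsReducedWord (n : ℕ) (w : Equiv.Perm ℕ) (L : List ℕ) : Prop :=
  IsWord n w L ∧ L.length = len n w

/-- `min_k(w)`: the minimum number of occurrences of `σ_k` in a reduced decomposition of `w`. -/
noncomputable def minOcc (n k : ℕ) (w : Equiv.Perm ℕ) : ℕ :=
  sInf {m | ∃ L : List ℕ, IsReducedWord n w L ∧ L.count k = m}

/-- `max_k(w)`: the maximum number of occurrences of `σ_k` in a reduced decomposition of `w`. -/
noncomputable def maxOcc (n k : ℕ) (w : Equiv.Perm ℕ) : ℕ :=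
  sSup {m | ∃ L : List ℕ, IsReducedWord n w L ∧ L.count k = m}

/-- `expat_k(w) = |{w(1),…,w(k)} ∩ {k+1,…,n}|`. -/
def expat (n k : ℕ) (w : Equiv.Perm ℕ) : ℕ :=
  (((Finset.Icc 1 k).image fun i => w i) ∩ Finset.Icc (k + 1) n).card

/-- A `321`-pattern of `w` in positions `i1 < i2 < i3` (within `[1, n]`). -/
def Is321At (n : ℕ) (w : Equiv.Perm ℕ) (i1 i2 i3 : ℕ) : Prop :=
  1 ≤ i1 ∧ i1 < i2 ∧ i2 < i3 ∧ i3 ≤ n ∧ w i3 < w i2 ∧ w i2 < w i1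

/-- A `3412`-pattern of `w` in positions `i1 < i2 < i3 < i4` (within `[1, n]`). -/
def Is3412At (n : ℕ) (w : Equiv.Perm ℕ) (i1 i2 i3 i4 : ℕ) : Prop :=
  1 ≤ i1 ∧ i1 < i2 ∧ i2 < i3 ∧ i3 < i4 ∧ i4 ≤ n ∧
    w i3 < w i4 ∧ w i4 < w i1 ∧ w i1 < w i2

/-- `p` is a position pair at `k`: `p = (i1, i3)` for a `321`-pattern with `i1 ≤ k < i3`,
or `p = (i2, i3)` for a `3412`-pattern with `i2 ≤ k < i3`. -/
def IsPosPair (n k : ℕ) (w : Equiv.Perm ℕ) (p : ℕ × ℕ) : Prop :=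
  (∃ i2, Is321At n w p.1 i2 p.2 ∧ p.1 ≤ k ∧ k < p.2) ∨
  (∃ i1 i4, Is3412At n w i1 p.1 p.2 i4 ∧ p.1 ≤ k ∧ k < p.2)

/-- `p` is a value pair at `k`: `p = (j3, j1)` for a `321`-pattern with values
`j1 < j2 < j3` and `j1 ≤ k < j3`, or `p = (j4, j1)` for a `3412`-pattern with values
`j1 < j2 < j3 < j4` and `j2 ≤ k < j3`. -/
def IsValPair (n k : ℕ) (w : Equiv.Perm ℕ) (p : ℕ × ℕ) : Prop :=
  (∃ i1 i2 i3, Is321At n w i1 i2 i3 ∧ w i3 ≤ k ∧ k < w i1 ∧ p = (w i1, w i3)) ∨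
  (∃ i1 i2 i3 i4, Is3412At n w i1 i2 i3 i4 ∧ w i4 ≤ k ∧ k < w i1 ∧ p = (w i2, w i3))

/-- `PosPair_k(w)`: the number of distinct position pairs at `k` in `w`. -/
noncomputable def posPairCount (n k : ℕ) (w : Equiv.Perm ℕ) : ℕ :=
  Set.ncard {p : ℕ × ℕ | IsPosPair n k w p}

/-- `ValPair_k(w)`: the number of distinct value pairs at `k` in `w`. -/
noncomputable def valPairCount (n k : ℕ) (w : Equiv.Perm ℕ) : ℕ :=
  Set.ncard {p : ℕ × ℕ | IsValPair n k w p}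


open Finset in
open Classical in
noncomputable def vpF (lt R : ℕ → ℕ → Prop) (U S T : Finset ℕ) : ℕ :=
  ∑ a ∈ U \ S, ((S.filter (fun s => lt a s)).card - (T.filter (fun t => ¬ R t a)).card)

open Classical in
theorem vpF_mono (lt R R' : ℕ → ℕ → Prop) (U S T T' : Finset ℕ)
    (h : ∀ a ∈ U, a ∉ S → (T.filter (fun t => ¬ R t a)).card ≤ (T'.filter (fun t => ¬ R' t a)).card) :
    vpF lt R' U S T' ≤ vpF lt R U S T := by
  unfold vpF
  apply Finset.sum_le_sum
  intro a ha
  rw [Finset.mem_sdiff] at ha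
  have := h a ha.1 ha.2
  omega

open Classical in
theorem vpF_own (lt R R' : ℕ → ℕ → Prop) (U S T : Finset ℕ) (a b : ℕ)
    (htr : ∀ x y z, lt x y → lt y z → lt x z) (hir : ∀ x, ¬ lt x x)
    (haU : a ∈ U) (haS : a ∉ S) (hbU : b ∈ U) (hbS : b ∈ S) (hab : lt a b)
    (hR : ∀ x, x ≠ a → ∀ t ∈ T, (R' t x ↔ R t x)) :
    1 + vpF lt R' U (insert a (S.erase b)) T ≤ vpF lt R U S T + (T.filter (fun t => ¬ R t a)).card := by
  have hne : a ≠ b := fun h => haS (h ▸ hbS)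
  have e1 : U \ (insert a (S.erase b)) = insert b ((U \ S).erase a) := by
    ext x
    simp only [Finset.mem_sdiff, Finset.mem_insert, Finset.mem_erase]
    by_cases hx : x = b
    · subst hx; simp [hbU, hne.symm]
    · by_cases hx' : x = a
      · subst hx'; simp [hx]
      · simp [hx, hx']
  have hb' : b ∉ (U \ S).erase a := by simp [hbS]
  unfold vpF
  rw [e1, Finset.sum_insert hb', ← Finset.add_sum_erase (U \ S) _ (Finset.mem_sdiff.2 ⟨haU, haS⟩)]
  have h1 : ∑ x ∈ (U \ S).erase a, (((insert a (S.erase b)).filter (fun s => lt x s)).card - (T.filter (fun t => ¬ R' t x)).card)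
      ≤ ∑ x ∈ (U \ S).erase a, ((S.filter (fun s => lt x s)).card - (T.filter (fun t => ¬ R t x)).card) := by
    apply Finset.sum_le_sum
    intro x hx
    rw [Finset.mem_erase, Finset.mem_sdiff] at hx
    have t1 : T.filter (fun t => ¬ R' t x) = T.filter (fun t => ¬ R t x) :=
      Finset.filter_congr (fun t ht => by rw [hR x hx.1 t ht])
    have t2 : ((insert a (S.erase b)).filter (fun s => lt x s)).card ≤ (S.filter (fun s => lt x s)).card := by
      by_cases hxa : lt x a
      · have hxb := htr _ _ _ hxa hab
        rw [Finset.filter_insert, if_pos hxa, Finset.filter_erase]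
        rw [Finset.card_insert_of_notMem (by simp [haS])]
        rw [Finset.card_erase_add_one (by simp [hbS, hxb])]
      · rw [Finset.filter_insert, if_neg hxa]
        exact Finset.card_le_card (Finset.filter_subset_filter _ (Finset.erase_subset _ _))
    rw [t1]; omega
  have h2 : ((insert a (S.erase b)).filter (fun s => lt b s)).card + 1 ≤ (S.filter (fun s => lt a s)).card := by
    have hba : ¬ lt b a := fun h => hir _ (htr _ _ _ h hab)
    rw [Finset.filter_insert, if_neg hba]
    rw [← Finset.card_erase_add_one (s := S.filter (fun s => lt a s)) (a := b) (by simp [hbS, hab])]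
    apply Nat.succ_le_succ
    apply Finset.card_le_card
    intro x hx
    simp only [Finset.mem_filter, Finset.mem_erase] at hx ⊢
    exact ⟨hx.1.1, hx.1.2, htr _ _ _ hab hx.2⟩
  omega

open Classical in
theorem vpF_ins (lt R R' : ℕ → ℕ → Prop) (U S T : Finset ℕ) (a b : ℕ)
    (haU : a ∈ U) (haS : a ∉ S) (hbT : b ∉ T)
    (hR : ∀ x ∈ U, x ∉ S → x ≠ a → ∀ t, R' t x ↔ R t x)
    (hb : ∀ x ∈ U, x ∉ S → x ≠ a → ¬ R b x) :
    vpF lt R' U (insert a S) (insert b T) +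
      ((S.filter (fun s => lt a s)).card - (T.filter (fun t => ¬ R t a)).card) ≤ vpF lt R U S T := by
  have e1 : U \ (insert a S) = (U \ S).erase a := by
    ext x; simp only [Finset.mem_sdiff, Finset.mem_insert, Finset.mem_erase]; tauto
  unfold vpF
  rw [e1, ← Finset.add_sum_erase (U \ S) _ (Finset.mem_sdiff.2 ⟨haU, haS⟩), add_comm]
  apply Nat.add_le_add_left
  apply Finset.sum_le_sum
  intro x hx
  rw [Finset.mem_erase, Finset.mem_sdiff] at hx
  obtain ⟨hxa, hxU, hxS⟩ := hx
  have t1 : (insert b T).filter (fun t => ¬ R' t x) = insert b (T.filter (fun t => ¬ R t x)) := by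
    rw [Finset.filter_congr (q := fun t => ¬ R t x) (fun t ht => by rw [hR x hxU hxS hxa t]),
      Finset.filter_insert, if_pos (hb x hxU hxS hxa)]
  rw [t1, Finset.card_insert_of_notMem (by simp [hbT])]
  have t2 : ((insert a S).filter (fun s => lt x s)).card ≤ (S.filter (fun s => lt x s)).card + 1 := by
    rw [Finset.filter_insert]
    split_ifs
    · exact Finset.card_insert_le _ _
    · omega
  omega

/-- inversions in terms of values -/
def vInv (u : Equiv.Perm ℕ) (x y : ℕ) : Prop := y < x ∧ u.symm x < u.symm y

def vVP (k : ℕ) (u : Equiv.Perm ℕ) (p : ℕ × ℕ) : Prop :=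
  p.2 ≤ k ∧ k < p.1 ∧ vInv u p.1 p.2 ∧
  ((∃ y, vInv u p.1 y ∧ vInv u y p.2) ∨
   (∃ x' z', p.2 < z' ∧ z' ≤ k ∧ k < x' ∧ x' < p.1 ∧ vInv u p.1 z' ∧ vInv u x' p.2 ∧ vInv u x' z'))

theorem vVP_mono (k : ℕ) (u u' : Equiv.Perm ℕ) (h : ∀ x y, vInv u x y → vInv u' x y)
    (p : ℕ × ℕ) (hp : vVP k u p) : vVP k u' p := by
  obtain ⟨h1, h2, h3, h4⟩ := hp
  refine ⟨h1, h2, h _ _ h3, ?_⟩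
  rcases h4 with ⟨y, a, b⟩ | ⟨x', z', a1, a2, a3, a4, a5, a6, a7⟩
  · exact Or.inl ⟨y, h _ _ a, h _ _ b⟩
  · exact Or.inr ⟨x', z', a1, a2, a3, a4, h _ _ a5, h _ _ a6, h _ _ a7⟩

theorem symm_step (u : Equiv.Perm ℕ) (i x : ℕ) :
    (u * simpleRefl i).symm x = if u.symm x = i then i + 1 else if u.symm x = i + 1 then i else u.symm x := by
  have : (u * simpleRefl i).symm x = Equiv.swap i (i+1) (u.symm x) := by
    rw [Equiv.symm_apply_eq]; simp [simpleRefl]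
  rw [this, Equiv.swap_apply_def]

theorem vInv_step (u : Equiv.Perm ℕ) (i : ℕ) (hi : u i < u (i + 1)) (x y : ℕ) (h : vInv u x y) :
    vInv (u * simpleRefl i) x y := by
  obtain ⟨h1, h2⟩ := h
  refine ⟨h1, ?_⟩
  rw [symm_step, symm_step]
  have key : ¬ (u.symm x = i ∧ u.symm y = i + 1) := by
    rintro ⟨a, b⟩
    rw [Equiv.symm_apply_eq] at a b
    omega
  split_ifs <;> omega

theorem vInv_new (u : Equiv.Perm ℕ) (i : ℕ) (hi : u i < u (i + 1)) :
    vInv (u * simpleRefl i) (u (i+1)) (u i) := by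
  refine ⟨hi, ?_⟩
  rw [symm_step, symm_step]; simp

theorem vVP_isValPair (n k : ℕ) (w : Equiv.Perm ℕ) (hw : IsPermOf n w) (p : ℕ × ℕ) (h : vVP k w p) :
    IsValPair n k w p := by
  have hfix : ∀ x, x = 0 ∨ n < x → w.symm x = x := by
    intro x hx
    rw [Equiv.symm_apply_eq, hw x]
    simp; omega
  have hge : ∀ x y, vInv w x y → 1 ≤ w.symm x := by
    intro x y hxy
    by_contra hc
    have h0 : w.symm x = 0 := by omega
    have : x = 0 := by
      have := hfix 0 (Or.inl rfl)
      exact w.symm.injective (by rw [h0, this])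
    have := hxy.1
    omega
  have hle : ∀ x y, vInv w x y → w.symm y ≤ n := by
    intro x y hxy
    by_contra hc
    have h0 := hfix (w.symm y) (Or.inr (by omega))
    have h1 : w.symm y = y := w.symm.injective h0
    have h2 := hxy.1
    have h3 := hfix x (Or.inr (by omega))
    have := hxy.2
    omega
  obtain ⟨x, z⟩ := p
  obtain ⟨h1, h2, h3, h4⟩ := h
  simp only at h1 h2 h3 h4
  have h321 : ∀ y, vInv w x y → vInv w y z → IsValPair n k w (x, z) := by
    intro y a b
    left
    refine ⟨w.symm x, w.symm y, w.symm z, ⟨hge _ _ a, a.2, b.2, hle _ _ b, ?_, ?_⟩, ?_, ?_, ?_⟩ <;> simp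
    · exact b.1
    · exact a.1
    · exact h1
    · exact h2
  rcases h4 with ⟨y, a, b⟩ | ⟨x', z', a1, a2, a3, a4, a5, a6, a7⟩
  · exact h321 y a b
  · rcases lt_trichotomy (w.symm x') (w.symm x) with hx | hx | hx
    · rcases lt_trichotomy (w.symm z) (w.symm z') with hz | hz | hz
      · right
        refine ⟨w.symm x', w.symm x, w.symm z, w.symm z', ⟨hge _ _ a6, hx, h3.2, hz, hle _ _ a5, ?_, ?_, ?_⟩, ?_, ?_, ?_⟩ <;> simp
        · exact a1
        · omega
        · exact a4
        · exact a2
        · exact a3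
      · have := w.symm.injective hz; omega
      · exact h321 z' a5 ⟨a1, hz⟩
    · have := w.symm.injective hx; omega
    · exact h321 x' ⟨a4, hx⟩ a6

theorem len_step (n : ℕ) (u : Equiv.Perm ℕ) (i : ℕ) (hi : 1 ≤ i) (hin : i + 1 ≤ n) :
    len n (u * simpleRefl i) ≤ len n u + (if u i < u (i + 1) then 1 else 0) := by
  unfold len
  set A := (Finset.Icc 1 n ×ˢ Finset.Icc 1 n).filter
    fun p : ℕ × ℕ => p.1 < p.2 ∧ (u * simpleRefl i) p.2 < (u * simpleRefl i) p.1 with hA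
  have hs : ∀ x, simpleRefl i x = if x = i then i + 1 else if x = i + 1 then i else x := by
    intro x; rw [simpleRefl, Equiv.swap_apply_def]
  have h1 : (A.erase (i, i+1)).card ≤ ((Finset.Icc 1 n ×ˢ Finset.Icc 1 n).filter
      fun p : ℕ × ℕ => p.1 < p.2 ∧ u p.2 < u p.1).card := by
    apply Finset.card_le_card_of_injOn (fun p => (simpleRefl i p.1, simpleRefl i p.2))
    · rintro ⟨x, y⟩ hxy
      have hxy' := Finset.mem_erase.1 (Finset.mem_coe.1 hxy)
      rw [Finset.mem_coe]
      obtain ⟨h5, h6⟩ := hxy'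
      rw [hA, Finset.mem_filter] at h6
      simp only [Finset.mem_filter, Finset.mem_product, ne_eq,
        Finset.mem_Icc, Equiv.Perm.mul_apply, Prod.mk.injEq] at h5 h6 ⊢
      obtain ⟨⟨h1, h2⟩, h3, h4⟩ := h6
      refine ⟨?_, ?_, h4⟩
      · rw [hs, hs]; split_ifs <;> omega
      · rw [hs, hs]; split_ifs <;> omega
    · rintro ⟨x, y⟩ _ ⟨x', y'⟩ _ h
      simp only [Prod.mk.injEq, EmbeddingLike.apply_eq_iff_eq] at h ⊢
      exact h
  split_ifs with h
  · have := Finset.pred_card_le_card_erase (s := A) (a := (i, i+1))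
    omega
  · have : (i, i+1) ∉ A := by
      simp only [hA, Finset.mem_filter, Equiv.Perm.mul_apply, hs]
      rintro ⟨-, -, h'⟩
      simp at h'
      omega
    rw [Finset.erase_eq_of_notMem this] at h1
    omega

def vS (k : ℕ) (u : Equiv.Perm ℕ) : Finset ℕ := (Finset.range (k + 1)).filter (fun x => k < u.symm x)
def vT (n k : ℕ) (u : Equiv.Perm ℕ) : Finset ℕ := (Finset.Ioc k n).filter (fun x => u.symm x ≤ k)

theorem mem_vS {k : ℕ} {u : Equiv.Perm ℕ} {x : ℕ} : x ∈ vS k u ↔ x ≤ k ∧ k < u.symm x := by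
  simp [vS]

theorem mem_vT {n k : ℕ} {u : Equiv.Perm ℕ} {x : ℕ} : x ∈ vT n k u ↔ (k < x ∧ x ≤ n) ∧ u.symm x ≤ k := by
  simp [vT]

noncomputable def vFS (n k : ℕ) (u : Equiv.Perm ℕ) (H : Finset (ℕ × ℕ)) : ℕ :=
  vpF (fun x y => x < y) (fun t s => (t, s) ∈ H) (Finset.range (k + 1)) (vS k u) (vT n k u)
noncomputable def vFT (n k : ℕ) (u : Equiv.Perm ℕ) (H : Finset (ℕ × ℕ)) : ℕ :=
  vpF (fun x y => y < x) (fun s t => (t, s) ∈ H) (Finset.Ioc k n) (vT n k u) (vS k u)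

structure VInvt (n k : ℕ) (u : Equiv.Perm ℕ) (c : ℕ) (H : Finset (ℕ × ℕ)) : Prop where
  hV : ∀ p ∈ H, vVP k u p
  hK : (vS k u).Nonempty → ∀ a b, a ≤ k → u.symm a ≤ k → k < b → k < u.symm b →
    (∃ t ∈ vT n k u, (t, a) ∉ H) ∨ (∃ s ∈ vS k u, (b, s) ∉ H)
  hc : c + vFS n k u H + vFT n k u H ≤ H.card + (if (vS k u).Nonempty then 1 else 0)

/-- a pair in `H` is inverted, so it cannot have the small value left and the large value right -/
theorem VInvt.nmem {n k : ℕ} {u : Equiv.Perm ℕ} {c : ℕ} {H : Finset (ℕ × ℕ)} (h : VInvt n k u c H)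
    {a b : ℕ} (ha : u.symm a ≤ k) (hb : k < u.symm b) : (b, a) ∉ H := by
  intro hm
  have := (h.hV _ hm).2.2.1.2
  simp only at this
  omega

theorem le_step (u : Equiv.Perm ℕ) (i k x : ℕ) (h : i ≠ k) :
    k < (u * simpleRefl i).symm x ↔ k < u.symm x := by
  rw [symm_step]; split_ifs <;> omega

theorem VInvt.step_ne {n k : ℕ} {u : Equiv.Perm ℕ} {c : ℕ} {H : Finset (ℕ × ℕ)} (h : VInvt n k u c H)
    (i : ℕ) (hik : i ≠ k) (hi : u i < u (i + 1)) : VInvt n k (u * simpleRefl i) c H := by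
  have hS : vS k (u * simpleRefl i) = vS k u := by
    ext x; rw [mem_vS, mem_vS, le_step u i k x hik]
  have hT : vT n k (u * simpleRefl i) = vT n k u := by
    ext x; rw [mem_vT, mem_vT, ← not_lt, ← not_lt, ← not_lt, le_step u i k x hik]
  refine ⟨fun p hp => vVP_mono k u _ (vInv_step u i hi) p (h.hV p hp), ?_, ?_⟩
  · rw [hS, hT]
    intro hn a b h1 h2 h3 h4
    rw [le_step u i k b hik] at h4
    rw [← not_lt, le_step u i k a hik, not_lt] at h2
    exact h.hK hn a b h1 h2 h3 h4
  · have := h.hc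
    unfold vFS vFT at this ⊢
    rw [hS, hT]
    exact this

theorem symm_k (u : Equiv.Perm ℕ) (k x : ℕ) :
    (k < (u * simpleRefl k).symm x ↔ x ≠ u (k+1) ∧ (x = u k ∨ k < u.symm x)) := by
  rw [symm_step]
  have e1 : x = u k ↔ u.symm x = k := by rw [Equiv.symm_apply_eq]
  have e2 : x = u (k+1) ↔ u.symm x = k + 1 := by rw [Equiv.symm_apply_eq]
  rw [ne_eq, e1, e2]
  split_ifs <;> omega

open Classical in
theorem card_union_col (H : Finset (ℕ × ℕ)) (T : Finset ℕ) (a : ℕ) :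
    (H ∪ T.image (fun t => (t, a))).card = H.card + (T.filter (fun t => (t, a) ∉ H)).card := by
  have : H ∪ T.image (fun t => (t, a)) = H ∪ (T.filter (fun t => (t, a) ∉ H)).image (fun t => (t, a)) := by
    ext p
    simp only [Finset.mem_union, Finset.mem_image, Finset.mem_filter]
    constructor
    · rintro (h | ⟨t, ht, rfl⟩)
      · exact Or.inl h
      · by_cases hm : (t, a) ∈ H
        · exact Or.inl hm
        · exact Or.inr ⟨t, ⟨ht, hm⟩, rfl⟩
    · rintro (h | ⟨t, ht, rfl⟩)
      · exact Or.inl h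
      · exact Or.inr ⟨t, ht.1, rfl⟩
  rw [this, Finset.card_union_of_disjoint, Finset.card_image_of_injective]
  · intro x y h; simpa using h
  · rw [Finset.disjoint_right]
    intro p hp
    simp only [Finset.mem_image, Finset.mem_filter] at hp
    obtain ⟨t, ht, rfl⟩ := hp
    exact ht.2

open Classical in
theorem card_union_row (H : Finset (ℕ × ℕ)) (S : Finset ℕ) (b : ℕ) :
    (H ∪ S.image (fun s => (b, s))).card = H.card + (S.filter (fun s => (b, s) ∉ H)).card := by
  have : H ∪ S.image (fun s => (b, s)) = H ∪ (S.filter (fun s => (b, s) ∉ H)).image (fun s => (b, s)) := by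
    ext p
    simp only [Finset.mem_union, Finset.mem_image, Finset.mem_filter]
    constructor
    · rintro (h | ⟨t, ht, rfl⟩)
      · exact Or.inl h
      · by_cases hm : (b, t) ∈ H
        · exact Or.inl hm
        · exact Or.inr ⟨t, ⟨ht, hm⟩, rfl⟩
    · rintro (h | ⟨t, ht, rfl⟩)
      · exact Or.inl h
      · exact Or.inr ⟨t, ht.1, rfl⟩
  rw [this, Finset.card_union_of_disjoint, Finset.card_image_of_injective]
  · intro x y h; simpa using h
  · rw [Finset.disjoint_right]
    intro p hp
    simp only [Finset.mem_image, Finset.mem_filter] at hp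
    obtain ⟨t, ht, rfl⟩ := hp
    exact ht.2

/-- replacing an element of `S` by an element outside the filter's complement -/
theorem card_replace (S : Finset ℕ) (P : ℕ → Prop) [DecidablePred P] (a b : ℕ) (ha : a ∉ S) (hP : P a) :
    (S.filter P).card ≤ ((insert a (S.erase b)).filter P).card := by
  rw [Finset.filter_insert, if_pos hP, Finset.filter_erase,
    Finset.card_insert_of_notMem (by simp [ha])]
  have := Finset.pred_card_le_card_erase (s := S.filter P) (a := b)
  omega

theorem VInvt.step2 {n k : ℕ} {u : Equiv.Perm ℕ} {c : ℕ} {H : Finset (ℕ × ℕ)} (h : VInvt n k u c H)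
    (hi : u k < u (k + 1)) (hb : u (k + 1) ≤ k) :
    ∃ H', VInvt n k (u * simpleRefl k) (c + 1) H' := by
  classical
  set u' := u * simpleRefl k with hu'
  set a := u k with ha
  set b := u (k+1) with hbd
  have sa : u.symm a = k := by simp [ha]
  have sb : u.symm b = k + 1 := by simp [hbd]
  have haS : a ∉ vS k u := by rw [mem_vS]; omega
  have hbS : b ∈ vS k u := by rw [mem_vS]; omega
  have hS : vS k u' = insert a ((vS k u).erase b) := by
    ext x
    rw [mem_vS, hu', symm_k, Finset.mem_insert, Finset.mem_erase, mem_vS, ← ha, ← hbd]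
    by_cases hxa : x = a
    · subst hxa; simp; omega
    · simp [hxa]; tauto
  have hT : vT n k u' = vT n k u := by
    ext x
    rw [mem_vT, mem_vT, ← not_lt (a := k) (b := u'.symm x), hu', symm_k, ← ha, ← hbd]
    constructor
    · rintro ⟨h1, h2⟩
      refine ⟨h1, ?_⟩
      by_contra h3
      exact h2 ⟨by omega, Or.inr (by omega)⟩
    · rintro ⟨h1, h2⟩
      refine ⟨h1, ?_⟩
      rintro ⟨h3, h4⟩
      omega
  refine ⟨H ∪ (vT n k u).image (fun t => (t, a)), ?_, ?_, ?_⟩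
  · intro p hp
    rw [Finset.mem_union, Finset.mem_image] at hp
    rcases hp with hp | ⟨t, ht, rfl⟩
    · exact vVP_mono k u _ (vInv_step u k hi) p (h.hV p hp)
    · rw [mem_vT] at ht
      have h1 : vInv u' b a := vInv_new u k hi
      have h2 : vInv u' t b := vInv_step u k hi _ _ ⟨by omega, by omega⟩
      exact ⟨by simp only; omega, by simp only; omega, ⟨by simp only; omega, lt_trans h2.2 h1.2⟩, Or.inl ⟨b, h2, h1⟩⟩
  · intro _ a' b' h1 h2 h3 h4
    right
    refine ⟨a, by rw [hS]; simp, ?_⟩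
    rw [hu', symm_k] at h4
    have h5 : k < u.symm b' := by
      rcases h4.2 with h5 | h5
      · omega
      · exact h5
    simp only [Finset.mem_union, Finset.mem_image, not_or]
    refine ⟨h.nmem (by omega) h5, ?_⟩
    rintro ⟨t, ht, he⟩
    rw [mem_vT] at ht
    simp only [Prod.mk.injEq, and_true] at he
    subst he
    omega
  · have hc := h.hc
    have hne : (vS k u).Nonempty := ⟨b, hbS⟩
    have hne' : (vS k u').Nonempty := ⟨a, by rw [hS]; simp⟩
    rw [if_pos hne] at hc
    rw [if_pos hne', card_union_col]
    unfold vFS vFT at hc ⊢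
    rw [hS, hT]
    have e1 := vpF_own (fun x y => x < y) (fun t s => (t, s) ∈ H)
      (fun t s => (t, s) ∈ H ∪ (vT n k u).image (fun t => (t, a)))
      (Finset.range (k + 1)) (vS k u) (vT n k u) a b (fun _ _ _ => lt_trans) (fun _ => lt_irrefl _)
      (by simp; omega) haS (by simp; omega) hbS hi
      (by
        intro x hx t ht
        simp only [Finset.mem_union, Finset.mem_image, Prod.mk.injEq, or_iff_left_iff_imp]
        rintro ⟨_, _, _, rfl⟩
        exact absurd rfl hx)
    have e2 := vpF_mono (fun x y => y < x) (fun s t => (t, s) ∈ H)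
      (fun s t => (t, s) ∈ H ∪ (vT n k u).image (fun t => (t, a)))
      (Finset.Ioc k n) (vT n k u) (vS k u) (insert a ((vS k u).erase b))
      (by
        intro x hx hxT
        have hxk : k < u.symm x := by
          rw [mem_vT] at hxT
          rw [Finset.mem_Ioc] at hx
          by_contra hcon
          exact hxT ⟨hx, by omega⟩
        have : ∀ s, ((x, s) ∈ H ∪ (vT n k u).image (fun t => (t, a))) ↔ (x, s) ∈ H := by
          intro s
          simp only [Finset.mem_union, Finset.mem_image, Prod.mk.injEq, or_iff_left_iff_imp]
          rintro ⟨t, ht, rfl, _⟩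
          exact absurd ht hxT
        simp only [this]
        have hnm : (x, a) ∉ H := h.nmem (by omega) hxk
        convert card_replace (vS k u) (fun s => (x, s) ∉ H) a b haS hnm)
    obtain ⟨Nq1, q1⟩ : ∃ N, ∀ i : DecidablePred (fun t => (t, a) ∉ H), (@Finset.filter ℕ (fun t => (t, a) ∉ H) i (vT n k u)).card = N := by
      refine ⟨((vT n k u).filter (fun t => (t, a) ∉ H)).card, fun i => ?_⟩
      congr!
    beta_reduce at e1
    rw [q1] at e1 ⊢
    omega

theorem VInvt.step3 {n k : ℕ} {u : Equiv.Perm ℕ} {c : ℕ} {H : Finset (ℕ × ℕ)} (h : VInvt n k u c H)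
    (hi : u k < u (k + 1)) (hb : k < u k) (hbn : u (k + 1) ≤ n) :
    ∃ H', VInvt n k (u * simpleRefl k) (c + 1) H' := by
  classical
  set u' := u * simpleRefl k with hu'
  set a := u k with ha
  set b := u (k+1) with hbd
  have sa : u.symm a = k := by simp [ha]
  have sb : u.symm b = k + 1 := by simp [hbd]
  have hbT : b ∉ vT n k u := by rw [mem_vT]; omega
  have haT : a ∈ vT n k u := by rw [mem_vT]; omega
  have hS : vS k u' = vS k u := by
    ext x
    rw [mem_vS, hu', symm_k, mem_vS, ← ha, ← hbd]
    constructor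
    · rintro ⟨h1, h2, h3⟩
      exact ⟨h1, h3.resolve_left (by omega)⟩
    · rintro ⟨h1, h2⟩
      exact ⟨h1, by omega, Or.inr h2⟩
  have hT : vT n k u' = insert b ((vT n k u).erase a) := by
    ext x
    rw [mem_vT, ← not_lt (a := k) (b := u'.symm x), hu', symm_k, Finset.mem_insert, Finset.mem_erase, mem_vT, ← ha, ← hbd,
      ← not_lt (a := k) (b := u.symm x)]
    by_cases hxb : x = b
    · subst hxb; simp; omega
    · simp [hxb]; tauto
  refine ⟨H ∪ (vS k u).image (fun s => (b, s)), ?_, ?_, ?_⟩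
  · intro p hp
    rw [Finset.mem_union, Finset.mem_image] at hp
    rcases hp with hp | ⟨t, ht, rfl⟩
    · exact vVP_mono k u _ (vInv_step u k hi) p (h.hV p hp)
    · rw [mem_vS] at ht
      have h1 : vInv u' b a := vInv_new u k hi
      have h2 : vInv u' a t := vInv_step u k hi _ _ ⟨by omega, by omega⟩
      exact ⟨by simp only; omega, by simp only; omega, ⟨by simp only; omega, lt_trans h1.2 h2.2⟩, Or.inl ⟨a, h1, h2⟩⟩
  · intro _ a' b' h1 h2 h3 h4
    left
    refine ⟨b, by rw [hT]; simp, ?_⟩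
    rw [← not_lt, hu', symm_k] at h2
    have h5 : u.symm a' ≤ k := by
      by_contra hcon
      exact h2 ⟨by omega, Or.inr (by omega)⟩
    simp only [Finset.mem_union, Finset.mem_image, not_or]
    refine ⟨h.nmem h5 (by omega), ?_⟩
    rintro ⟨t, ht, he⟩
    rw [mem_vS] at ht
    simp only [Prod.mk.injEq, true_and] at he
    subst he
    omega
  · have hc := h.hc
    rw [hS, card_union_row]
    unfold vFS vFT at hc ⊢
    rw [hS, hT]
    have e1 := vpF_own (fun x y => y < x) (fun s t => (t, s) ∈ H)
      (fun s t => (t, s) ∈ H ∪ (vS k u).image (fun s => (b, s)))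
      (Finset.Ioc k n) (vT n k u) (vS k u) b a (fun _ _ _ h1 h2 => lt_trans h2 h1) (fun _ => lt_irrefl _)
      (by simp; omega) hbT (by simp; omega) haT hi
      (by
        intro x hx t ht
        simp only [Finset.mem_union, Finset.mem_image, Prod.mk.injEq, or_iff_left_iff_imp]
        rintro ⟨_, _, rfl, _⟩
        exact absurd rfl hx)
    have e2 := vpF_mono (fun x y => x < y) (fun t s => (t, s) ∈ H)
      (fun t s => (t, s) ∈ H ∪ (vS k u).image (fun s => (b, s)))
      (Finset.range (k + 1)) (vS k u) (vT n k u) (insert b ((vT n k u).erase a))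
      (by
        intro x hx hxS
        have hxk : u.symm x ≤ k := by
          rw [mem_vS] at hxS
          rw [Finset.mem_range] at hx
          by_contra hcon
          exact hxS ⟨by omega, by omega⟩
        have : ∀ t, ((t, x) ∈ H ∪ (vS k u).image (fun s => (b, s))) ↔ (t, x) ∈ H := by
          intro s
          simp only [Finset.mem_union, Finset.mem_image, Prod.mk.injEq, or_iff_left_iff_imp]
          rintro ⟨t, ht, _, rfl⟩
          exact absurd ht hxS
        simp only [this]
        have hnm : (b, x) ∉ H := h.nmem hxk (by omega)
        convert card_replace (vT n k u) (fun t => (t, x) ∉ H) b a hbT hnm)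
    obtain ⟨Nq1, q1⟩ : ∃ N, ∀ i : DecidablePred (fun s => (b, s) ∉ H), (@Finset.filter ℕ (fun s => (b, s) ∉ H) i (vS k u)).card = N := by
      refine ⟨((vS k u).filter (fun s => (b, s) ∉ H)).card, fun i => ?_⟩
      congr!
    beta_reduce at e1
    rw [q1] at e1 ⊢
    omega

theorem VInvt.step1 {n k : ℕ} {u : Equiv.Perm ℕ} {c : ℕ} {H : Finset (ℕ × ℕ)} (h : VInvt n k u c H)
    (hak : u k ≤ k) (hb : k < u (k + 1)) (hbn : u (k + 1) ≤ n) :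
    ∃ H', VInvt n k (u * simpleRefl k) (c + 1) H' := by
  classical
  have hi : u k < u (k + 1) := by omega
  set u' := u * simpleRefl k with hu'
  set a := u k with ha
  set b := u (k+1) with hbd
  have sa : u.symm a = k := by simp [ha]
  have sb : u.symm b = k + 1 := by simp [hbd]
  have haS : a ∉ vS k u := by rw [mem_vS]; omega
  have hbT : b ∉ vT n k u := by rw [mem_vT]; omega
  have hS : vS k u' = insert a (vS k u) := by
    ext x
    rw [mem_vS, hu', symm_k, Finset.mem_insert, mem_vS, ← ha, ← hbd]
    by_cases hxa : x = a
    · subst hxa; simp; omega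
    · simp [hxa]
      intro h1 h2 h3
      omega
  have hT : vT n k u' = insert b (vT n k u) := by
    ext x
    rw [mem_vT, ← not_lt (a := k) (b := u'.symm x), hu', symm_k, Finset.mem_insert, mem_vT, ← ha, ← hbd,
      ← not_lt (a := k) (b := u.symm x)]
    by_cases hxb : x = b
    · subst hxb; simp; omega
    · simp [hxb]
      intro h1 h2 h3
      omega
  have hba : vInv u' b a := vInv_new u k hi
  have hmon := vInv_step u k hi
  -- generic construction
  have build : ∀ N : Finset (ℕ × ℕ), (∀ p ∈ N, vVP k u' p ∧ p.1 ∈ vT n k u' ∧ p.2 ∈ vS k u') →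
      (c + 1 + vFS n k u H + vFT n k u H ≤ (H ∪ N).card + 1 +
        (((vS k u).filter (fun s => a < s)).card - ((vT n k u).filter (fun t => (t, a) ∉ H)).card) +
        (((vT n k u).filter (fun t => t < b)).card - ((vS k u).filter (fun s => (b, s) ∉ H)).card)) →
      ∃ H', VInvt n k u' (c + 1) H' := by
    intro N hN hcard
    refine ⟨H ∪ N, ?_, ?_, ?_⟩
    · intro p hp
      rw [Finset.mem_union] at hp
      rcases hp with hp | hp
      · exact vVP_mono k u _ hmon p (h.hV p hp)
      · exact (hN p hp).1
    · intro _ a' b' h1 h2 h3 h4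
      right
      refine ⟨a, by rw [hS]; simp, ?_⟩
      have h5 : k < u.symm b' := by
        rw [hu', symm_k] at h4
        rcases h4.2 with h5 | h5
        · omega
        · exact h5
      simp only [Finset.mem_union, not_or]
      refine ⟨h.nmem (by omega) h5, fun hm => ?_⟩
      have := (hN _ hm).2.1
      rw [mem_vT] at this
      simp only at this
      omega
    · have hne' : (vS k u').Nonempty := ⟨a, by rw [hS]; simp⟩
      rw [if_pos hne']
      unfold vFS vFT at hcard ⊢
      have e1 := vpF_ins (fun x y => x < y) (fun t s => (t, s) ∈ H) (fun t s => (t, s) ∈ H ∪ N)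
        (Finset.range (k + 1)) (vS k u) (vT n k u) a b (by simp; omega) haS hbT
        (by
          intro x hx hxS hxa t
          simp only [Finset.mem_union, or_iff_left_iff_imp]
          intro hm
          have := (hN _ hm).2.2
          rw [hS, Finset.mem_insert] at this
          exact absurd this (by simp [hxS, hxa]))
        (by
          intro x hx hxS hxa
          have hxk : u.symm x ≤ k := by
            rw [mem_vS] at hxS
            rw [Finset.mem_range] at hx
            by_contra hcon
            exact hxS ⟨by omega, by omega⟩
          exact h.nmem hxk (by omega))
      have e2 := vpF_ins (fun x y => y < x) (fun s t => (t, s) ∈ H) (fun s t => (t, s) ∈ H ∪ N)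
        (Finset.Ioc k n) (vT n k u) (vS k u) b a (by simp; omega) hbT haS
        (by
          intro x hx hxS hxa t
          simp only [Finset.mem_union, or_iff_left_iff_imp]
          intro hm
          have := (hN _ hm).2.1
          rw [hT, Finset.mem_insert] at this
          exact absurd this (by simp [hxS, hxa]))
        (by
          intro x hx hxS hxa
          have hxk : k < u.symm x := by
            rw [mem_vT] at hxS
            rw [Finset.mem_Ioc] at hx
            by_contra hcon
            exact hxS ⟨by omega, by omega⟩
          exact h.nmem (by omega) hxk)
      obtain ⟨Nq1, q1⟩ : ∃ N, ∀ i : DecidablePred (fun t => (t, a) ∉ H), (@Finset.filter ℕ (fun t => (t, a) ∉ H) i (vT n k u)).card = N := by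
        refine ⟨((vT n k u).filter (fun t => (t, a) ∉ H)).card, fun i => ?_⟩
        congr!
      beta_reduce at e1
      rw [q1] at e1 hcard
      obtain ⟨Nq2, q2⟩ : ∃ N, ∀ i : DecidablePred (fun s => a < s), (@Finset.filter ℕ (fun s => a < s) i (vS k u)).card = N := by
        refine ⟨((vS k u).filter (fun s => a < s)).card, fun i => ?_⟩
        congr!
      beta_reduce at e1
      rw [q2] at e1 hcard
      obtain ⟨Nq3, q3⟩ : ∃ N, ∀ i : DecidablePred (fun s => (b, s) ∉ H), (@Finset.filter ℕ (fun s => (b, s) ∉ H) i (vS k u)).card = N := by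
        refine ⟨((vS k u).filter (fun s => (b, s) ∉ H)).card, fun i => ?_⟩
        congr!
      beta_reduce at e2
      rw [q3] at e2 hcard
      obtain ⟨Nq4, q4⟩ : ∃ N, ∀ i : DecidablePred (fun t => t < b), (@Finset.filter ℕ (fun t => t < b) i (vT n k u)).card = N := by
        refine ⟨((vT n k u).filter (fun t => t < b)).card, fun i => ?_⟩
        congr!
      beta_reduce at e2
      rw [q4] at e2 hcard
      rw [hS, hT]
      omega
  have hc := h.hc
  by_cases hne : (vS k u).Nonempty
  swap
  · rw [if_neg hne] at hc
    exact build ∅ (by simp) (by simp only [Finset.union_empty]; omega)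
  rw [if_pos hne] at hc
  have build1 : ∀ p, vVP k u' p → p.1 ∈ vT n k u' → p.2 ∈ vS k u' → p ∉ H →
      ∃ H', VInvt n k u' (c + 1) H' := by
    intro p h1 h2 h3 h4
    apply build {p}
    · intro q hq
      rw [Finset.mem_singleton] at hq
      subst hq
      exact ⟨h1, h2, h3⟩
    · rw [Finset.card_union_of_disjoint (by simpa using h4), Finset.card_singleton]
      omega
  -- basic inversions
  have it_a : ∀ t ∈ vT n k u, vInv u' t a := by
    intro t ht
    rw [mem_vT] at ht
    apply hmon
    refine ⟨by omega, ?_⟩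
    have : u.symm t ≠ u.symm a := fun he => by have := u.symm.injective he; omega
    omega
  have ib_s : ∀ s ∈ vS k u, vInv u' b s := by
    intro s hs
    rw [mem_vS] at hs
    apply hmon
    refine ⟨by omega, ?_⟩
    have : u.symm s ≠ u.symm b := fun he => by have := u.symm.injective he; omega
    omega
  have it_s : ∀ t ∈ vT n k u, ∀ s ∈ vS k u, vInv u' t s := by
    intro t ht s hs
    rw [mem_vT] at ht
    rw [mem_vS] at hs
    apply hmon
    exact ⟨by omega, by omega⟩
  have it_b : ∀ t ∈ vT n k u, b < t → vInv u' t b := by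
    intro t ht hlt
    rw [mem_vT] at ht
    apply hmon
    exact ⟨hlt, by omega⟩
  have ia_s : ∀ s ∈ vS k u, s < a → vInv u' a s := by
    intro t ht hlt
    rw [mem_vS] at ht
    apply hmon
    exact ⟨hlt, by omega⟩
  have caseT : ∀ t ∈ vT n k u, b < t → (t, a) ∉ H → ∃ H', VInvt n k u' (c + 1) H' := by
    intro t ht hlt hm
    refine build1 (t, a) ⟨hak, by simp only; omega, it_a t ht, Or.inl ⟨b, it_b t ht hlt, hba⟩⟩ ?_ ?_ hm
    · rw [hT]; simp [ht]
    · rw [hS]; simp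
  have caseS : ∀ s ∈ vS k u, s < a → (b, s) ∉ H → ∃ H', VInvt n k u' (c + 1) H' := by
    intro s hs hlt hm
    refine build1 (b, s) ⟨by simp only; omega, hb, ib_s s hs, Or.inl ⟨a, hba, ia_s s hs hlt⟩⟩ ?_ ?_ hm
    · rw [hT]; simp
    · rw [hS]; simp [hs]
  have ltT : ∀ t ∈ vT n k u, ¬ t < b → b < t := by
    intro t ht hn
    have : t ≠ b := fun he => hbT (he ▸ ht)
    omega
  have ltS : ∀ s ∈ vS k u, ¬ a < s → s < a := by
    intro t ht hn
    have : t ≠ a := fun he => haS (he ▸ ht)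
    omega
  have hK := h.hK hne a b hak (by omega) hb (by omega)
  by_cases hT1 : ∃ t ∈ vT n k u, t < b
  · by_cases hS1 : ∃ s ∈ vS k u, a < s
    · obtain ⟨t, ht, htb⟩ := hT1
      obtain ⟨s, hs, hsa⟩ := hS1
      have hs' := mem_vS.1 hs
      have ht' := mem_vT.1 ht
      refine build1 (b, a) ⟨hak, hb, hba, Or.inr ⟨t, s, hsa, hs'.1, ht'.1.1, htb, ib_s s hs, it_a t ht, it_s t ht s hs⟩⟩ ?_ ?_
        (h.nmem (by omega) (by omega))
      · rw [hT]; simp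
      · rw [hS]; simp
    · push Not at hS1
      by_cases hex : ∃ s ∈ vS k u, (b, s) ∉ H
      · obtain ⟨s, hs, hm⟩ := hex
        exact caseS s hs (ltS s hs (by have := hS1 s hs; omega)) hm
      · obtain ⟨t, ht, hm⟩ := hK.resolve_right hex
        by_cases htb : t < b
        · apply build ∅ (by simp)
          have z1 : ((vS k u).filter (fun s => (b, s) ∉ H)).card = 0 := by
            rw [Finset.card_eq_zero, Finset.filter_eq_empty_iff]
            intro s hs hm'
            exact hex ⟨s, hs, hm'⟩
          have z2 : 0 < ((vT n k u).filter (fun t => t < b)).card :=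
            Finset.card_pos.2 ⟨t, by simp [ht, htb]⟩
          simp only [Finset.union_empty]
          omega
        · exact caseT t ht (ltT t ht htb) hm
  · push Not at hT1
    by_cases hex : ∃ t ∈ vT n k u, (t, a) ∉ H
    · obtain ⟨t, ht, hm⟩ := hex
      exact caseT t ht (ltT t ht (by have := hT1 t ht; omega)) hm
    · obtain ⟨s, hs, hm⟩ := hK.resolve_left hex
      by_cases hsa : a < s
      · apply build ∅ (by simp)
        have z1 : ((vT n k u).filter (fun t => (t, a) ∉ H)).card = 0 := by
          rw [Finset.card_eq_zero, Finset.filter_eq_empty_iff]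
          intro s hs hm'
          exact hex ⟨s, hs, hm'⟩
        have z2 : 0 < ((vS k u).filter (fun s => a < s)).card :=
          Finset.card_pos.2 ⟨s, by simp [hs, hsa]⟩
        simp only [Finset.union_empty]
        omega
      · exact caseS s hs (ltS s hs hsa) hm

theorem isPermOf_step (n : ℕ) (u : Equiv.Perm ℕ) (i : ℕ) (hu : IsPermOf n u) (hi : 1 ≤ i) (hin : i + 1 ≤ n) :
    IsPermOf n (u * simpleRefl i) := by
  intro x hx
  have h1 : simpleRefl i x = x := by
    rw [Finset.mem_Icc] at hx
    exact Equiv.swap_apply_of_ne_of_ne (by omega) (by omega)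
  rw [Equiv.Perm.mul_apply, h1, hu x hx]

theorem len_word (n : ℕ) (L : List ℕ) (hL : ∀ i ∈ L, 1 ≤ i ∧ i + 1 ≤ n) :
    len n (L.map simpleRefl).prod ≤ L.length := by
  induction L using List.reverseRecOn with
  | nil =>
    simp only [List.map_nil, List.prod_nil, List.length_nil, Nat.le_zero, len, Finset.card_eq_zero,
      Finset.filter_eq_empty_iff, Equiv.Perm.one_apply]
    intro x _ h
    omega
  | append_singleton L i ih =>
    have h1 := ih (fun j hj => hL j (by simp [hj]))
    have h2 := hL i (by simp)
    have h3 := len_step n (L.map simpleRefl).prod i h2.1 h2.2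
    simp only [List.map_append, List.map_cons, List.map_nil, List.prod_append, List.prod_cons, List.prod_nil,
      mul_one, List.length_append, List.length_cons, List.length_nil]
    split_ifs at h3 <;> omega

theorem main_invt (n k : ℕ) (hk : k + 1 ≤ n) (L : List ℕ) (hL : ∀ i ∈ L, 1 ≤ i ∧ i + 1 ≤ n)
    (hr : L.length ≤ len n (L.map simpleRefl).prod) :
    IsPermOf n (L.map simpleRefl).prod ∧ ∃ H, VInvt n k (L.map simpleRefl).prod (L.count k) H := by
  induction L using List.reverseRecOn with
  | nil =>
    simp only [List.map_nil, List.prod_nil, List.count_nil]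
    refine ⟨fun x _ => rfl, ∅, ?_, ?_, ?_⟩
    · simp
    · rintro ⟨x, hx⟩
      rw [mem_vS] at hx
      have : (Equiv.symm (1 : Equiv.Perm ℕ)) x = x := rfl
      omega
    · have h1 : vS k 1 = ∅ := by
        ext x
        rw [mem_vS]
        have : (Equiv.symm (1 : Equiv.Perm ℕ)) x = x := rfl
        simp; omega
      have h2 : vT n k 1 = ∅ := by
        ext x
        rw [mem_vT]
        have : (Equiv.symm (1 : Equiv.Perm ℕ)) x = x := rfl
        simp; omega
      simp [vFS, vFT, vpF, h1, h2]
  | append_singleton L i ih =>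
    have h2 := hL i (by simp)
    have hL' : ∀ j ∈ L, 1 ≤ j ∧ j + 1 ≤ n := fun j hj => hL j (by simp [hj])
    have h3 := len_step n (L.map simpleRefl).prod i h2.1 h2.2
    have h4 := len_word n L hL'
    simp only [List.map_append, List.map_cons, List.map_nil, List.prod_append, List.prod_cons, List.prod_nil,
      mul_one, List.length_append, List.length_cons, List.length_nil, List.count_append] at hr ⊢
    have hi : (L.map simpleRefl).prod i < (L.map simpleRefl).prod (i + 1) := by
      by_contra hcon
      rw [if_neg hcon] at h3
      omega
    rw [if_pos hi] at h3
    obtain ⟨hp, H, hH⟩ := ih hL' (by omega)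
    refine ⟨isPermOf_step n _ i hp h2.1 h2.2, ?_⟩
    generalize (L.map simpleRefl).prod = u at *
    by_cases hik : i = k
    · subst hik
      rw [List.count_singleton_self]
      have hbn : u (i + 1) ≤ n := by
        by_contra hcon
        have h5 := hp (u (i + 1)) (by rw [Finset.mem_Icc]; omega)
        have := u.injective h5
        omega
      by_cases c1 : u (i + 1) ≤ i
      · exact hH.step2 hi c1
      · by_cases c2 : i < u i
        · exact hH.step3 hi c2 hbn
        · exact hH.step1 (by omega) (by omega) hbn
    · rw [List.count_singleton, if_neg (by simpa using hik)]
      exact ⟨H, hH.step_ne i hik hi⟩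

/-- The number of `σ_k` factors in any reduced decomposition of `w`
is at most `ValPair_k(w) + 1`. -/
theorem count_le_valPair_succ (n : ℕ) (hn : 2 ≤ n) (w : Equiv.Perm ℕ)
    (hw : IsPermOf n w) (k : ℕ) (hk1 : 1 ≤ k) (hk2 : k ≤ n - 1)
    (L : List ℕ) (hL : IsReducedWord n w L) :
    L.count k ≤ valPairCount n k w + 1 := by
  obtain ⟨⟨h1, h2⟩, h3⟩ := hL
  have h1' : ∀ i ∈ L, 1 ≤ i ∧ i + 1 ≤ n := fun i hi => by
    have := h1 i hi
    omega
  obtain ⟨-, H, hH⟩ := main_invt n k (by omega) L h1' (by rw [h2]; omega)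
  rw [h2] at hH
  have hc := hH.hc
  have hfin : {p : ℕ × ℕ | IsValPair n k w p}.Finite := by
    apply Set.Finite.subset (((Finset.range (n+1)) ×ˢ (Finset.range (n+1))).image
      (fun p : ℕ × ℕ => (w p.1, w p.2))).finite_toSet
    rintro p (⟨i1, i2, i3, ⟨a1, a2, a3, a4, -⟩, -, -, rfl⟩ | ⟨i1, i2, i3, i4, ⟨a1, a2, a3, a4, a5, -⟩, -, -, rfl⟩)
    · simp only [Finset.coe_image, Set.mem_image, Finset.mem_coe, Finset.mem_product, Finset.mem_range]
      exact ⟨(i1, i3), ⟨by simp only; omega, by simp only; omega⟩, rfl⟩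
    · simp only [Finset.coe_image, Set.mem_image, Finset.mem_coe, Finset.mem_product, Finset.mem_range]
      exact ⟨(i2, i3), ⟨by simp only; omega, by simp only; omega⟩, rfl⟩
  have hle : H.card ≤ valPairCount n k w := by
    rw [← Set.ncard_coe_finset]
    exact Set.ncard_le_ncard (fun p hp => vVP_isValPair n k w hw p (hH.hV p hp)) hfin
  split_ifs at hc <;> omega
end

section
/- Fix n ≥ 3 and k ∈ {1,…,n−1}, and let w0 ∈ S_n be the longest element, w0(i) = n+1−i for all i. Then max_k(w0) ≤ k(n−k). -/
def invs (n : ℕ) (w : Equiv.Perm ℕ) : Finset (ℕ × ℕ) :=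
  (Finset.Icc 1 n ×ˢ Finset.Icc 1 n).filter fun p => p.1 < p.2 ∧ w p.2 < w p.1

theorem simpleRefl_eq (i x : ℕ) :
    simpleRefl i x = if x = i then i + 1 else if x = i + 1 then i else x := by
  simp only [simpleRefl, Equiv.swap_apply_def]

theorem invs_step (n i : ℕ) (h1 : 1 ≤ i) (h2 : i + 1 ≤ n) (u : Equiv.Perm ℕ) :
    ((invs n (u * simpleRefl i)).erase (i, i + 1)).card ≤ (invs n u).card := by
  apply Finset.card_le_card_of_injOn (fun p => (simpleRefl i p.1, simpleRefl i p.2))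
  · rintro ⟨a, b⟩ h
    rw [Finset.mem_coe] at h ⊢
    simp only [invs, Finset.mem_erase, Finset.mem_filter, Finset.mem_product, Finset.mem_Icc,
      ne_eq, Prod.mk.injEq] at h ⊢
    obtain ⟨hne, ⟨ha, hb⟩, hab, hu⟩ := h
    rw [Equiv.Perm.mul_apply, Equiv.Perm.mul_apply] at hu
    refine ⟨?_, ?_, hu⟩
    · rw [simpleRefl_eq, simpleRefl_eq]; split_ifs <;> omega
    · rw [simpleRefl_eq, simpleRefl_eq]; split_ifs <;> omega
  · rintro ⟨a, b⟩ _ ⟨c, d⟩ _ h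
    simpa using h

theorem len_le_succ (n i : ℕ) (h1 : 1 ≤ i) (h2 : i + 1 ≤ n) (u : Equiv.Perm ℕ) :
    len n (u * simpleRefl i) ≤ len n u + 1 := by
  have h := invs_step n i h1 h2 u
  have h' := Finset.pred_card_le_card_erase (s := invs n (u * simpleRefl i)) (a := (i, i + 1))
  change (invs n (u * simpleRefl i)).card ≤ (invs n u).card + 1
  omega

theorem len_le_of_desc (n i : ℕ) (h1 : 1 ≤ i) (h2 : i + 1 ≤ n) (u : Equiv.Perm ℕ)
    (hd : u (i + 1) ≤ u i) : len n (u * simpleRefl i) ≤ len n u := by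
  have h := invs_step n i h1 h2 u
  rw [Finset.erase_eq_of_notMem] at h
  · exact h
  · simp only [invs, Finset.mem_filter, Equiv.Perm.mul_apply, simpleRefl_eq]
    simp
    intros
    omega

theorem sum_step_ne (k i : ℕ) (h1 : 1 ≤ i) (hik : i ≠ k) (u : Equiv.Perm ℕ) :
    ∑ x ∈ Finset.Icc 1 k, (u * simpleRefl i) x = ∑ x ∈ Finset.Icc 1 k, u x := by
  apply Finset.sum_equiv (simpleRefl i)
  · intro x
    rw [Finset.mem_Icc, Finset.mem_Icc, simpleRefl_eq]
    split_ifs <;> omega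
  · intro x _
    rfl

theorem sum_step_eq (k : ℕ) (h1 : 1 ≤ k) (u : Equiv.Perm ℕ) (h : u k < u (k + 1)) :
    ∑ x ∈ Finset.Icc 1 k, u x + 1 ≤ ∑ x ∈ Finset.Icc 1 k, (u * simpleRefl k) x := by
  apply Nat.succ_le_of_lt
  apply Finset.sum_lt_sum
  · intro x hx
    rw [Finset.mem_Icc] at hx
    rw [Equiv.Perm.mul_apply, simpleRefl_eq]
    split_ifs with h3 h4
    · subst h3; exact h.le
    · omega
    · exact le_rfl
  · refine ⟨k, by simp [h1], ?_⟩
    rw [Equiv.Perm.mul_apply, simpleRefl_eq, if_pos rfl]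
    exact h

theorem key (n k : ℕ) (L : List ℕ) :
    (∀ i ∈ L, 1 ≤ i ∧ i ≤ n - 1) →
    len n (L.map simpleRefl).prod ≤ L.length ∧
    (L.length = len n (L.map simpleRefl).prod →
      L.count k + ∑ x ∈ Finset.Icc 1 k, x ≤
        ∑ x ∈ Finset.Icc 1 k, (L.map simpleRefl).prod x) := by
  induction L using List.reverseRecOn with
  | nil =>
    intro _
    constructor
    · simp only [len, List.map_nil, List.prod_nil, List.length_nil, Nat.le_zero,
        Finset.card_eq_zero, Equiv.Perm.one_apply]
      apply Finset.filter_false_of_mem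
      intro x _
      omega
    · simp
  | append_singleton L i ih =>
    intro hL
    obtain ⟨ih1, ih2⟩ := ih (fun j hj => hL j (by simp [hj]))
    obtain ⟨hi1, hi2⟩ := hL i (by simp)
    have hi3 : i + 1 ≤ n := by omega
    simp only [List.map_append, List.map_cons, List.map_nil, List.prod_append, List.prod_cons,
      List.prod_nil, mul_one, List.length_append, List.length_cons, List.length_nil,
      List.count_append]
    generalize (L.map simpleRefl).prod = u at *
    have hs := len_le_succ n i hi1 hi3 u
    refine ⟨by omega, fun he => ?_⟩
    have hlt : u i < u (i + 1) := by
      by_contra hc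
      have := len_le_of_desc n i hi1 hi3 u (by omega)
      omega
    have ih3 := ih2 (by omega)
    by_cases hik : i = k
    · subst hik
      have := sum_step_eq i hi1 u hlt
      simp
      simp at this
      omega
    · rw [sum_step_ne k i hi1 hik]
      simpa [List.count_singleton, hik] using ih3

theorem sum_w0 (n m : ℕ) (h : m ≤ n) :
    ∑ x ∈ Finset.Icc 1 m, (n + 1 - x) = m * (n - m) + ∑ x ∈ Finset.Icc 1 m, x := by
  induction m with
  | zero => simp
  | succ m ih =>
    rw [Finset.sum_Icc_succ_top (by omega), Finset.sum_Icc_succ_top (by omega), ih (by omega)]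
    obtain ⟨d, rfl⟩ := Nat.exists_eq_add_of_le h
    have e1 : m + 1 + d - m = d + 1 := by omega
    have e2 : m + 1 + d + 1 - (m + 1) = d + 1 := by omega
    have e3 : m + 1 + d - (m + 1) = d := by omega
    rw [e1, e2, e3]
    ring

/-- Corollary, maximum for the longest element. For `n ≥ 3` and the
longest element `w0` of `S_n` (with `w0(i) = n+1-i` on `[1,n]`),
`max_k(w0) ≤ k(n-k)`. -/
theorem maxOcc_longest_element_le (n : ℕ) (hn : 3 ≤ n) (k : ℕ) (hk1 : 1 ≤ k)
    (hk2 : k ≤ n - 1) (w0 : Equiv.Perm ℕ) (hw0 : IsPermOf n w0)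
    (hw0' : ∀ i ∈ Finset.Icc 1 n, w0 i = n + 1 - i) :
    maxOcc n k w0 ≤ k * (n - k) := by
  apply csSup_le'
  rintro m ⟨L, ⟨⟨hL, hp⟩, hlen⟩, rfl⟩
  have h := (key n k L hL).2 (by rw [hp]; exact hlen)
  rw [hp] at h
  have h2 : ∑ x ∈ Finset.Icc 1 k, w0 x = ∑ x ∈ Finset.Icc 1 k, (n + 1 - x) := by
    apply Finset.sum_congr rfl
    intro x hx
    rw [Finset.mem_Icc] at hx
    exact hw0' x (by rw [Finset.mem_Icc]; omega)
  rw [h2, sum_w0 n k (by omega)] at h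
  omega
end

section
/- Fix n ≥ 2, w ∈ S_n, and k ∈ {1,…,n−1}. Then max_k(w) > min_k(w) if and only if there exists a 321-pattern in w straddling position k, in positions i < m ≤ k < j (or i ≤ k < m < j) with w(i) > w(m) > w(j), such that the sets L_w := {w(q) : i < q ≤ k, w(q) > w(i)} and R_w := {w(q) : k < q < j, w(q) < w(j)} satisfy |L_w| = |R_w| and the elements of L_w appear in increasing order from left to right in w, as do the elements of R_w. -/
theorem profileR (f : ℕ → ℕ) (hf : Function.Injective f) (T : Finset ℕ) :
    ∃ N, (∀ r < N, ∃ t ∈ T, (∀ s1 ∈ T, ∀ s2 ∈ T, s1 < t → s2 < t → f s1 < f t → f s2 < f t →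
        s1 < s2 → f s1 < f s2) ∧ (T.filter fun s => s < t ∧ f s < f t).card = r) ∧
      ((N = T.card ∧ ∀ s1 ∈ T, ∀ s2 ∈ T, s1 < s2 → f s1 < f s2) ∨
        ∃ q ∈ T, ∃ p ∈ T, p < q ∧ f q < f p ∧
          (∀ s1 ∈ T, ∀ s2 ∈ T, s1 < q → s2 < q → f s1 < f q → f s2 < f q →
            s1 < s2 → f s1 < f s2) ∧ (T.filter fun s => s < q ∧ f s < f q).card < N) := by
  induction T using Finset.induction_on_max with
  | empty => exact ⟨0, by simp, Or.inl ⟨by simp, by simp⟩⟩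
  | insert x T hx ih =>
    have hxT : x ∉ T := fun h => lt_irrefl _ (hx x h)
    have hfil : ∀ t ∈ T, ((insert x T).filter fun s => s < t ∧ f s < f t) =
        T.filter fun s => s < t ∧ f s < f t := by
      intro t ht
      have := hx t ht
      ext s
      simp only [Finset.mem_filter, Finset.mem_insert]
      constructor
      · rintro ⟨rfl | h, h2⟩
        · omega
        · exact ⟨h, h2⟩
      · rintro ⟨h, h2⟩; exact ⟨Or.inr h, h2⟩
    have hinc : ∀ t ∈ T, (∀ s1 ∈ T, ∀ s2 ∈ T, s1 < t → s2 < t → f s1 < f t → f s2 < f t →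
        s1 < s2 → f s1 < f s2) → (∀ s1 ∈ insert x T, ∀ s2 ∈ insert x T, s1 < t → s2 < t →
        f s1 < f t → f s2 < f t → s1 < s2 → f s1 < f s2) := by
      intro t ht h s1 h1 s2 h2 a1 a2
      have := hx t ht
      rw [Finset.mem_insert] at h1 h2
      have h1 : s1 ∈ T := h1.resolve_left (by omega)
      have h2 : s2 ∈ T := h2.resolve_left (by omega)
      exact h s1 h1 s2 h2 a1 a2
    obtain ⟨N, hN, h | ⟨q, hq, p, hp, hpq, hf1, hi, hc⟩⟩ := ih
    · obtain ⟨hNc, hch⟩ := h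
      have hfx : ((insert x T).filter fun s => s < x ∧ f s < f x) =
        T.filter fun s => f s < f x := by
        ext s
        simp only [Finset.mem_filter, Finset.mem_insert]
        constructor
        · rintro ⟨rfl | h, h2⟩
          · omega
          · exact ⟨h, h2.2⟩
        · rintro ⟨h, h2⟩; exact ⟨Or.inr h, hx s h, h2⟩
      have hix : (∀ s1 ∈ insert x T, ∀ s2 ∈ insert x T, s1 < x → s2 < x →
        f s1 < f x → f s2 < f x → s1 < s2 → f s1 < f s2) := by
        intro s1 h1 s2 h2 a1 a2 _ _ a3
        rw [Finset.mem_insert] at h1 h2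
        exact hch s1 (h1.resolve_left (by omega)) s2 (h2.resolve_left (by omega)) a3
      by_cases hall : ∀ s ∈ T, f s < f x
      · refine ⟨N + 1, ?_, Or.inl ⟨by rw [Finset.card_insert_of_notMem hxT, hNc], ?_⟩⟩
        · intro r hr
          rcases Nat.lt_succ_iff_lt_or_eq.1 hr with hr | rfl
          · obtain ⟨t, ht, h1, h2⟩ := hN r hr
            exact ⟨t, Finset.mem_insert_of_mem ht, hinc t ht h1, by rw [hfil t ht, h2]⟩
          · refine ⟨x, Finset.mem_insert_self _ _, hix, ?_⟩
            rw [hfx, Finset.filter_true_of_mem hall, hNc]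
        · intro s1 h1 s2 h2 h12
          rw [Finset.mem_insert] at h1 h2
          rcases h1 with rfl | h1 <;> rcases h2 with rfl | h2
          · omega
          · have := hx s2 h2; omega
          · exact hall _ h1
          · exact hch _ h1 _ h2 h12
      · push Not at hall
        obtain ⟨p, hp, hpx⟩ := hall
        have hne : f x ≠ f p := fun h => hxT (hf h ▸ hp)
        refine ⟨N, ?_, Or.inr ⟨x, Finset.mem_insert_self _ _, p, Finset.mem_insert_of_mem hp,
          hx p hp, by omega, hix, ?_⟩⟩
        · intro r hr
          obtain ⟨t, ht, h1, h2⟩ := hN r hr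
          exact ⟨t, Finset.mem_insert_of_mem ht, hinc t ht h1, by rw [hfil t ht, h2]⟩
        · rw [hfx, hNc]
          apply Finset.card_lt_card
          refine Finset.filter_ssubset.2 ⟨p, hp, by omega⟩
    · refine ⟨N, ?_, Or.inr ⟨q, Finset.mem_insert_of_mem hq, p, Finset.mem_insert_of_mem hp,
          hpq, hf1, hinc q hq hi, by rw [hfil q hq]; exact hc⟩⟩
      intro r hr
      obtain ⟨t, ht, h1, h2⟩ := hN r hr
      exact ⟨t, Finset.mem_insert_of_mem ht, hinc t ht h1, by rw [hfil t ht, h2]⟩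

/-- `R(t)` is increasing of size `r`. -/
def RI (w : ℕ → ℕ) (k t r : ℕ) : Prop :=
  ((Finset.Ioo k t).filter fun q => w q < w t).card = r ∧
  (∀ q1 ∈ (Finset.Ioo k t).filter fun q => w q < w t,
          ∀ q2 ∈ (Finset.Ioo k t).filter fun q => w q < w t,
            q1 < q2 → w q1 < w q2)

def LI (w : ℕ → ℕ) (k i r : ℕ) : Prop :=
  ((Finset.Ioc i k).filter fun q => w i < w q).card = r ∧
  (∀ q1 ∈ (Finset.Ioc i k).filter fun q => w i < w q,
          ∀ q2 ∈ (Finset.Ioc i k).filter fun q => w i < w q,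
            q1 < q2 → w q1 < w q2)

theorem profR (w : ℕ → ℕ) (hf : Function.Injective w) (k : ℕ) (T : Finset ℕ)
    (hT : ∀ t ∈ T, k < t ∧ ∀ q, k < q → q < t → w q < w t → q ∈ T) :
    ∃ N, (∀ r < N, ∃ t ∈ T, RI w k t r) ∧
      ((N = T.card ∧ ∀ s1 ∈ T, ∀ s2 ∈ T, s1 < s2 → w s1 < w s2) ∨
        ∃ q ∈ T, ∃ p ∈ T, p < q ∧ w q < w p ∧ ∃ r, RI w k q r ∧ r < N) := by
  have key : ∀ t ∈ T, (T.filter fun s => s < t ∧ w s < w t) =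
      (Finset.Ioo k t).filter fun q => w q < w t := by
    intro t ht
    ext s
    simp only [Finset.mem_filter, Finset.mem_Ioo]
    constructor
    · rintro ⟨h, h2, h3⟩
      exact ⟨⟨(hT s h).1, h2⟩, h3⟩
    · rintro ⟨⟨h, h2⟩, h3⟩
      exact ⟨(hT t ht).2 s h h2 h3, h2, h3⟩
  have conv : ∀ t ∈ T, ∀ r, (∀ s1 ∈ T, ∀ s2 ∈ T, s1 < t → s2 < t → w s1 < w t → w s2 < w t →
        s1 < s2 → w s1 < w s2) → (T.filter fun s => s < t ∧ w s < w t).card = r → RI w k t r := by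
    intro t ht r h1 h2
    refine ⟨by rw [← key t ht, h2], ?_⟩
    rw [← key t ht]
    intro q1 hq1 q2 hq2
    rw [Finset.mem_filter] at hq1 hq2
    exact h1 q1 hq1.1 q2 hq2.1 hq1.2.1 hq2.2.1 hq1.2.2 hq2.2.2
  obtain ⟨N, hN, h⟩ := profileR w hf T
  refine ⟨N, ?_, ?_⟩
  · intro r hr
    obtain ⟨t, ht, h1, h2⟩ := hN r hr
    exact ⟨t, ht, conv t ht r h1 h2⟩
  · rcases h with h | ⟨q, hq, p, hp, hpq, hf1, hi, hc⟩
    · exact Or.inl h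
    · exact Or.inr ⟨q, hq, p, hp, hpq, hf1, _, conv q hq _ hi rfl, hc⟩

theorem profileL (f : ℕ → ℕ) (hf : Function.Injective f) (T : Finset ℕ) :
    ∃ N, (∀ r < N, ∃ t ∈ T, (∀ s1 ∈ T, ∀ s2 ∈ T, t < s1 → t < s2 → f t < f s1 → f t < f s2 →
        s1 < s2 → f s1 < f s2) ∧ (T.filter fun s => t < s ∧ f t < f s).card = r) ∧
      ((N = T.card ∧ ∀ s1 ∈ T, ∀ s2 ∈ T, s1 < s2 → f s1 < f s2) ∨
        ∃ q ∈ T, ∃ p ∈ T, q < p ∧ f p < f q ∧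
          (∀ s1 ∈ T, ∀ s2 ∈ T, q < s1 → q < s2 → f q < f s1 → f q < f s2 →
            s1 < s2 → f s1 < f s2) ∧ (T.filter fun s => q < s ∧ f q < f s).card < N) := by
  induction T using Finset.induction_on_min with
  | empty => exact ⟨0, by simp, Or.inl ⟨by simp, by simp⟩⟩
  | insert x T hx ih =>
    have hxT : x ∉ T := fun h => lt_irrefl _ (hx x h)
    have hfil : ∀ t ∈ T, ((insert x T).filter fun s => t < s ∧ f t < f s) =
        T.filter fun s => t < s ∧ f t < f s := by
      intro t ht
      have := hx t ht
      ext s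
      simp only [Finset.mem_filter, Finset.mem_insert]
      constructor
      · rintro ⟨rfl | h, h2⟩
        · omega
        · exact ⟨h, h2⟩
      · rintro ⟨h, h2⟩; exact ⟨Or.inr h, h2⟩
    have hinc : ∀ t ∈ T, (∀ s1 ∈ T, ∀ s2 ∈ T, t < s1 → t < s2 → f t < f s1 → f t < f s2 →
        s1 < s2 → f s1 < f s2) → (∀ s1 ∈ insert x T, ∀ s2 ∈ insert x T, t < s1 → t < s2 →
        f t < f s1 → f t < f s2 → s1 < s2 → f s1 < f s2) := by
      intro t ht h s1 h1 s2 h2 a1 a2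
      have := hx t ht
      rw [Finset.mem_insert] at h1 h2
      have h1 : s1 ∈ T := h1.resolve_left (by omega)
      have h2 : s2 ∈ T := h2.resolve_left (by omega)
      exact h s1 h1 s2 h2 a1 a2
    obtain ⟨N, hN, h | ⟨q, hq, p, hp, hpq, hf1, hi, hc⟩⟩ := ih
    · obtain ⟨hNc, hch⟩ := h
      have hfx : ((insert x T).filter fun s => x < s ∧ f x < f s) =
        T.filter fun s => f x < f s := by
        ext s
        simp only [Finset.mem_filter, Finset.mem_insert]
        constructor
        · rintro ⟨rfl | h, h2⟩
          · omega
          · exact ⟨h, h2.2⟩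
        · rintro ⟨h, h2⟩; exact ⟨Or.inr h, hx s h, h2⟩
      have hix : (∀ s1 ∈ insert x T, ∀ s2 ∈ insert x T, x < s1 → x < s2 →
        f x < f s1 → f x < f s2 → s1 < s2 → f s1 < f s2) := by
        intro s1 h1 s2 h2 a1 a2 _ _ a3
        rw [Finset.mem_insert] at h1 h2
        exact hch s1 (h1.resolve_left (by omega)) s2 (h2.resolve_left (by omega)) a3
      by_cases hall : ∀ s ∈ T, f x < f s
      · refine ⟨N + 1, ?_, Or.inl ⟨by rw [Finset.card_insert_of_notMem hxT, hNc], ?_⟩⟩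
        · intro r hr
          rcases Nat.lt_succ_iff_lt_or_eq.1 hr with hr | rfl
          · obtain ⟨t, ht, h1, h2⟩ := hN r hr
            exact ⟨t, Finset.mem_insert_of_mem ht, hinc t ht h1, by rw [hfil t ht, h2]⟩
          · refine ⟨x, Finset.mem_insert_self _ _, hix, ?_⟩
            rw [hfx, Finset.filter_true_of_mem hall, hNc]
        · intro s1 h1 s2 h2 h12
          rw [Finset.mem_insert] at h1 h2
          rcases h1 with rfl | h1 <;> rcases h2 with rfl | h2
          · omega
          · exact hall _ h2
          · have := hx s1 h1; omega
          · exact hch _ h1 _ h2 h12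
      · push Not at hall
        obtain ⟨p, hp, hpx⟩ := hall
        have hne : f x ≠ f p := fun h => hxT (hf h ▸ hp)
        refine ⟨N, ?_, Or.inr ⟨x, Finset.mem_insert_self _ _, p, Finset.mem_insert_of_mem hp,
          hx p hp, by omega, hix, ?_⟩⟩
        · intro r hr
          obtain ⟨t, ht, h1, h2⟩ := hN r hr
          exact ⟨t, Finset.mem_insert_of_mem ht, hinc t ht h1, by rw [hfil t ht, h2]⟩
        · rw [hfx, hNc]
          apply Finset.card_lt_card
          refine Finset.filter_ssubset.2 ⟨p, hp, by omega⟩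
    · refine ⟨N, ?_, Or.inr ⟨q, Finset.mem_insert_of_mem hq, p, Finset.mem_insert_of_mem hp,
          hpq, hf1, hinc q hq hi, by rw [hfil q hq]; exact hc⟩⟩
      intro r hr
      obtain ⟨t, ht, h1, h2⟩ := hN r hr
      exact ⟨t, Finset.mem_insert_of_mem ht, hinc t ht h1, by rw [hfil t ht, h2]⟩

theorem profL (w : ℕ → ℕ) (hf : Function.Injective w) (k : ℕ) (T : Finset ℕ)
    (hT : ∀ t ∈ T, t ≤ k ∧ ∀ q, t < q → q ≤ k → w t < w q → q ∈ T) :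
    ∃ N, (∀ r < N, ∃ t ∈ T, LI w k t r) ∧
      ((N = T.card ∧ ∀ s1 ∈ T, ∀ s2 ∈ T, s1 < s2 → w s1 < w s2) ∨
        ∃ q ∈ T, ∃ p ∈ T, q < p ∧ w p < w q ∧ ∃ r, LI w k q r ∧ r < N) := by
  have key : ∀ t ∈ T, (T.filter fun s => t < s ∧ w t < w s) =
      (Finset.Ioc t k).filter fun q => w t < w q := by
    intro t ht
    ext s
    simp only [Finset.mem_filter, Finset.mem_Ioc]
    constructor
    · rintro ⟨h, h2, h3⟩
      exact ⟨⟨h2, (hT s h).1⟩, h3⟩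
    · rintro ⟨⟨h, h2⟩, h3⟩
      exact ⟨(hT t ht).2 s h h2 h3, h, h3⟩
  have conv : ∀ t ∈ T, ∀ r, (∀ s1 ∈ T, ∀ s2 ∈ T, t < s1 → t < s2 → w t < w s1 → w t < w s2 →
        s1 < s2 → w s1 < w s2) → (T.filter fun s => t < s ∧ w t < w s).card = r → LI w k t r := by
    intro t ht r h1 h2
    refine ⟨by rw [← key t ht, h2], ?_⟩
    rw [← key t ht]
    intro q1 hq1 q2 hq2
    rw [Finset.mem_filter] at hq1 hq2
    exact h1 q1 hq1.1 q2 hq2.1 hq1.2.1 hq2.2.1 hq1.2.2 hq2.2.2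
  obtain ⟨N, hN, h⟩ := profileL w hf T
  refine ⟨N, ?_, ?_⟩
  · intro r hr
    obtain ⟨t, ht, h1, h2⟩ := hN r hr
    exact ⟨t, ht, conv t ht r h1 h2⟩
  · rcases h with h | ⟨q, hq, p, hp, hpq, hf1, hi, hc⟩
    · exact Or.inl h
    · exact Or.inr ⟨q, hq, p, hp, hpq, hf1, _, conv q hq _ hi rfl, hc⟩

def Goal321 (n k : ℕ) (w : ℕ → ℕ) : Prop :=
  ∃ i m j l, 1 ≤ i ∧ i < m ∧ m < j ∧ j ≤ n ∧ w j < w m ∧ w m < w i ∧ i ≤ k ∧ k < j ∧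
    LI w k i l ∧ RI w k j l

theorem FR (n k : ℕ) (w : ℕ → ℕ) (hf : Function.Injective w) (i j : ℕ) (h1 : 1 ≤ i)
    (hik : i ≤ k) (hkj : k < j) (hjn : j ≤ n) (hw : w j < w i)
    (hU : ((Finset.Icc 1 n).filter fun q => (i < q ∧ w i < w q) ∨ (j < q ∧ w j < w q)).card
      + k + 1 ≤ n) (M : ℕ) (hM : ∀ r < M, ∃ p, i ≤ p ∧ p ≤ k ∧ w i ≤ w p ∧ LI w k p r)
    (r : ℕ) (hrM : r < M) (hr : RI w k j r)
    (hl : r < ((Finset.Ioc i k).filter fun q => w i < w q).card) : Goal321 n k w := by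
  have H1 : (∃ x, k < x ∧ x < j ∧ w j < w x ∧ w x < w i) ∨ (∃ x, j < x ∧ x ≤ n ∧ w x < w j) := by
    by_contra hcon
    push Not at hcon
    obtain ⟨c1, c2⟩ := hcon
    set R := (Finset.Ioo k j).filter fun q => w q < w j with hR
    set L := (Finset.Ioc i k).filter fun q => w i < w q with hL
    have hjR : j ∉ R := by simp [hR]
    have hsub : insert j R ⊆ Finset.Ioc k n := by
      intro q hq
      simp only [hR, Finset.mem_insert, Finset.mem_filter, Finset.mem_Ioo] at hq
      rw [Finset.mem_Ioc]; omega
    have hc := Finset.card_sdiff_of_subset hsub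
    have hc' := Finset.card_le_card hsub
    rw [Finset.card_insert_of_notMem hjR, Nat.card_Ioc] at hc hc'
    have hd : Disjoint L (Finset.Ioc k n \ insert j R) := by
      rw [Finset.disjoint_left]
      intro q hq hq2
      simp only [hL, Finset.mem_filter, Finset.mem_Ioc] at hq
      simp only [Finset.mem_sdiff, Finset.mem_Ioc] at hq2
      omega
    have hs : L ∪ (Finset.Ioc k n \ insert j R) ⊆
        (Finset.Icc 1 n).filter fun q => (i < q ∧ w i < w q) ∨ (j < q ∧ w j < w q) := by
      intro q hq
      rw [Finset.mem_filter, Finset.mem_Icc]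
      rw [Finset.mem_union] at hq
      rcases hq with hq | hq
      · simp only [hL, Finset.mem_filter, Finset.mem_Ioc] at hq
        omega
      · simp only [hR, Finset.mem_sdiff, Finset.mem_Ioc, Finset.mem_insert, Finset.mem_filter,
          Finset.mem_Ioo, not_or] at hq
        obtain ⟨⟨q1, q2⟩, q3, q4⟩ := hq
        have n1 : w q ≠ w j := fun h => q3 (hf h)
        have n2 : w q ≠ w i := fun h => by have := hf h; omega
        have d1 := c1 q
        have d2 := c2 q
        refine ⟨by omega, ?_⟩
        rcases lt_or_gt_of_ne q3 with h | h
        · left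
          have : w j < w q := by
            by_contra hh
            exact q4 ⟨⟨q1, h⟩, by omega⟩
          have := d1 q1 h this
          omega
        · right
          have := d2 h q2
          omega
    have := Finset.card_le_card hs
    rw [Finset.card_union_of_disjoint hd, hc] at this
    have e : R.card = r := hr.1
    omega
  rcases H1 with ⟨x, a1, a2, a3, a4⟩ | hx
  · obtain ⟨p, b1, b2, b3, b4⟩ := hM r hrM
    exact ⟨p, x, j, r, by omega, by omega, a2, hjn, a3, by omega, b2, hkj, b4, hr⟩
  · classical
    obtain ⟨a1, a2, a3⟩ := Nat.find_spec hx
    have hmin := fun q (h : q < Nat.find hx) => Nat.find_min hx h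
    set x := Nat.find hx with hxd
    have hsub : ((Finset.Ioo k x).filter fun q => w q < w x) ⊆
        (Finset.Ioo k j).filter fun q => w q < w j := by
      intro q hq
      simp only [Finset.mem_filter, Finset.mem_Ioo] at hq ⊢
      have h1 := hmin q hq.1.2
      have h2 : q ≠ j := by rintro rfl; omega
      refine ⟨⟨hq.1.1, ?_⟩, by omega⟩
      by_contra hh
      exact h1 ⟨by omega, by omega, by omega⟩
    have hcard := Finset.card_le_card hsub
    rw [hr.1] at hcard
    obtain ⟨p, b1, b2, b3, b4⟩ := hM _ (lt_of_le_of_lt hcard hrM)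
    exact ⟨p, j, x, _, by omega, by omega, a1, a2, a3, by omega, b2, by omega, b4, rfl,
      fun q1 h1 q2 h2 => hr.2 q1 (hsub h1) q2 (hsub h2)⟩

theorem FL (n k : ℕ) (w : ℕ → ℕ) (hf : Function.Injective w) (i j : ℕ) (h1 : 1 ≤ i)
    (hik : i ≤ k) (hkj : k < j) (hjn : j ≤ n) (hw : w j < w i)
    (hD : ((Finset.Icc 1 n).filter fun q => (q < i ∧ w q < w i) ∨ (q < j ∧ w q < w j)).card
      + 1 ≤ k) (N : ℕ) (hN : ∀ r < N, ∃ p, p ≤ j ∧ k < p ∧ w p ≤ w j ∧ RI w k p r)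
    (r : ℕ) (hrN : r < N) (hr : LI w k i r)
    (hl : r < ((Finset.Ioo k j).filter fun q => w q < w j).card) : Goal321 n k w := by
  have H1 : (∃ x, i < x ∧ x ≤ k ∧ w j < w x ∧ w x < w i) ∨ (∃ x, x < i ∧ 1 ≤ x ∧ w i < w x) := by
    by_contra hcon
    push Not at hcon
    obtain ⟨c1, c2⟩ := hcon
    set R := (Finset.Ioo k j).filter fun q => w q < w j with hR
    set L := (Finset.Ioc i k).filter fun q => w i < w q with hL
    have hiL : i ∉ L := by simp [hL]
    have hsub : insert i L ⊆ Finset.Icc 1 k := by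
      intro q hq
      simp only [hL, Finset.mem_insert, Finset.mem_filter, Finset.mem_Ioc] at hq
      rw [Finset.mem_Icc]; omega
    have hc := Finset.card_sdiff_of_subset hsub
    have hc' := Finset.card_le_card hsub
    rw [Finset.card_insert_of_notMem hiL, Nat.card_Icc] at hc hc'
    have hd : Disjoint R (Finset.Icc 1 k \ insert i L) := by
      rw [Finset.disjoint_left]
      intro q hq hq2
      simp only [hR, Finset.mem_filter, Finset.mem_Ioo] at hq
      simp only [Finset.mem_sdiff, Finset.mem_Icc] at hq2
      omega
    have hs : R ∪ (Finset.Icc 1 k \ insert i L) ⊆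
        (Finset.Icc 1 n).filter fun q => (q < i ∧ w q < w i) ∨ (q < j ∧ w q < w j) := by
      intro q hq
      rw [Finset.mem_filter, Finset.mem_Icc]
      rw [Finset.mem_union] at hq
      rcases hq with hq | hq
      · simp only [hR, Finset.mem_filter, Finset.mem_Ioo] at hq
        omega
      · simp only [hL, Finset.mem_sdiff, Finset.mem_Ioc, Finset.mem_insert, Finset.mem_filter,
          Finset.mem_Icc, not_or] at hq
        obtain ⟨⟨q1, q2⟩, q3, q4⟩ := hq
        have n1 : w q ≠ w i := fun h => q3 (hf h)
        have n2 : w q ≠ w j := fun h => by have := hf h; omega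
        have d1 := c1 q
        have d2 := c2 q
        refine ⟨by omega, ?_⟩
        rcases lt_or_gt_of_ne q3 with h | h
        · left
          have := d2 h q1
          omega
        · right
          have : w q < w i := by
            by_contra hh
            exact q4 ⟨⟨h, q2⟩, by omega⟩
          have : w q < w j := by
            by_contra hh
            have := d1 h q2 (by omega)
            omega
          omega
    have := Finset.card_le_card hs
    rw [Finset.card_union_of_disjoint hd, hc] at this
    have e : L.card = r := hr.1
    omega
  rcases H1 with ⟨x, a1, a2, a3, a4⟩ | hx
  · obtain ⟨p, b1, b2, b3, b4⟩ := hN r hrN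
    exact ⟨i, x, p, r, by omega, by omega, by omega, by omega, by omega, a4, hik, b2, hr, b4⟩
  · classical
    have hx' : ∃ z, (z ≤ i ∧ (∃ x, x = i - z ∧ x < i ∧ 1 ≤ x ∧ w i < w x)) := by
      obtain ⟨x, a, b, c⟩ := hx
      exact ⟨i - x, by omega, x, by omega, a, b, c⟩
    obtain ⟨a0, x, hxe, a1, a2, a3⟩ := Nat.find_spec hx'
    have hmin : ∀ q, x < q → ¬ (q < i ∧ 1 ≤ q ∧ w i < w q) := by
      intro q hq hc
      exact Nat.find_min hx' (m := i - q) (by omega) ⟨by omega, q, by omega, hc⟩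
    have hsub : ((Finset.Ioc x k).filter fun q => w x < w q) ⊆
        (Finset.Ioc i k).filter fun q => w i < w q := by
      intro q hq
      simp only [Finset.mem_filter, Finset.mem_Ioc] at hq ⊢
      have h1 := hmin q hq.1.1
      have h2 : q ≠ i := by rintro rfl; omega
      refine ⟨⟨?_, hq.1.2⟩, by omega⟩
      by_contra hh
      exact h1 ⟨by omega, by omega, by omega⟩
    have hcard := Finset.card_le_card hsub
    rw [hr.1] at hcard
    obtain ⟨p, b1, b2, b3, b4⟩ := hN _ (lt_of_le_of_lt hcard hrN)
    exact ⟨x, i, p, _, by omega, by omega, by omega, by omega, by omega, a3, by omega, by omega,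
      ⟨rfl, fun q1 h1 q2 h2 => hr.2 q1 (hsub h1) q2 (hsub h2)⟩, b4⟩

theorem memA {w : ℕ → ℕ} {i k p : ℕ} :
    p ∈ insert i ((Finset.Ioc i k).filter fun q => w i < w q) ↔ 
    p = i ∨ (i < p ∧ p ≤ k ∧ w i < w p) := by
  simp only [Finset.mem_insert, Finset.mem_filter, Finset.mem_Ioc, and_assoc]

theorem memT {w : ℕ → ℕ} {j k p : ℕ} :
    p ∈ insert j ((Finset.Ioo k j).filter fun q => w q < w j) ↔ 
    p = j ∨ (k < p ∧ p < j ∧ w p < w j) := by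
  simp only [Finset.mem_insert, Finset.mem_filter, Finset.mem_Ioo, and_assoc]

theorem profA (w : ℕ → ℕ) (hf : Function.Injective w) (i k : ℕ) (hik : i ≤ k) :
    ∃ M, (∀ r < M, ∃ p, i ≤ p ∧ p ≤ k ∧ w i ≤ w p ∧ LI w k p r) ∧
      ((∃ l, M = l + 1 ∧ LI w k i l) ∨
        ∃ p y r, i ≤ p ∧ p < y ∧ y ≤ k ∧ w i ≤ w y ∧ w y < w p ∧ LI w k p r ∧ r < M ∧ 
          r ≤ ((Finset.Ioc i k).filter fun q => w i < w q).card) := by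
  obtain ⟨M, hM, h⟩ := profL w hf k (insert i ((Finset.Ioc i k).filter fun q => w i < w q)) (by
    intro t ht
    rw [memA] at ht
    refine ⟨by omega, ?_⟩
    intro q h1 h2 h3
    rw [memA]
    rcases ht with rfl | ht <;> omega)
  have ex : ∀ p, p = i ∨ (i < p ∧ p ≤ k ∧ w i < w p) → i ≤ p ∧ p ≤ k ∧ w i ≤ w p := by
    rintro p (rfl | h) <;> omega
  refine ⟨M, ?_, ?_⟩
  · intro r hr
    obtain ⟨t, ht, h1⟩ := hM r hr
    rw [memA] at ht
    obtain ⟨a, b, c⟩ := ex t ht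
    exact ⟨t, a, b, c, h1⟩
  · rcases h with ⟨h1, h2⟩ | ⟨p, hp, y, hy, hpy, hw, r, hr, hrM⟩
    · left
      refine ⟨_, ?_, rfl, ?_⟩
      · rw [h1, Finset.card_insert_of_notMem (by simp)]
      · intro q1 a1 q2 a2
        exact h2 q1 (Finset.mem_insert_of_mem a1) q2 (Finset.mem_insert_of_mem a2)
    · right
      rw [memA] at hp hy
      obtain ⟨a, b, c⟩ := ex p hp
      obtain ⟨a', b', c'⟩ := ex y hy
      refine ⟨p, y, r, a, hpy, b', c', hw, hr, hrM, ?_⟩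
      rw [← hr.1]
      apply Finset.card_le_card
      intro q
      simp only [Finset.mem_filter, Finset.mem_Ioc]
      omega

theorem profT (w : ℕ → ℕ) (hf : Function.Injective w) (j k : ℕ) (hkj : k < j) :
    ∃ M, (∀ r < M, ∃ p, p ≤ j ∧ k < p ∧ w p ≤ w j ∧ RI w k p r) ∧
      ((∃ l, M = l + 1 ∧ RI w k j l) ∨
        ∃ p y r, p ≤ j ∧ y < p ∧ k < y ∧ w y ≤ w j ∧ w p < w y ∧ RI w k p r ∧ r < M ∧ 
          r ≤ ((Finset.Ioo k j).filter fun q => w q < w j).card) := by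
  obtain ⟨M, hM, h⟩ := profR w hf k (insert j ((Finset.Ioo k j).filter fun q => w q < w j)) (by
    intro t ht
    rw [memT] at ht
    refine ⟨by omega, ?_⟩
    intro q h1 h2 h3
    rw [memT]
    rcases ht with rfl | ht <;> omega)
  have ex : ∀ p, p = j ∨ (k < p ∧ p < j ∧ w p < w j) → p ≤ j ∧ k < p ∧ w p ≤ w j := by
    rintro p (rfl | h) <;> omega
  refine ⟨M, ?_, ?_⟩
  · intro r hr
    obtain ⟨t, ht, h1⟩ := hM r hr
    rw [memT] at ht
    obtain ⟨a, b, c⟩ := ex t ht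
    exact ⟨t, a, b, c, h1⟩
  · rcases h with ⟨h1, h2⟩ | ⟨p, hp, y, hy, hpy, hw, r, hr, hrM⟩
    · left
      refine ⟨_, ?_, rfl, ?_⟩
      · rw [h1, Finset.card_insert_of_notMem (by simp)]
      · intro q1 a1 q2 a2
        exact h2 q1 (Finset.mem_insert_of_mem a1) q2 (Finset.mem_insert_of_mem a2)
    · right
      rw [memT] at hp hy
      obtain ⟨a, b, c⟩ := ex p hp
      obtain ⟨a', b', c'⟩ := ex y hy
      refine ⟨p, y, r, a, hpy, b', c', hw, hr, hrM, ?_⟩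
      rw [← hr.1]
      apply Finset.card_le_card
      intro q
      simp only [Finset.mem_filter, Finset.mem_Ioo]
      omega

theorem straddle (n k : ℕ) (w : ℕ → ℕ) (hf : Function.Injective w) (i m j : ℕ) (h1 : 1 ≤ i)
    (hik : i ≤ k) (hkj : k < j) (hjn : j ≤ n) (him : i < m) (hmj : m < j)
    (hw1 : w j < w m) (hw2 : w m < w i)
    (hU : ((Finset.Icc 1 n).filter fun q => (i < q ∧ w i < w q) ∨ (j < q ∧ w j < w q)).card
      + k + 1 ≤ n)
    (hD : ((Finset.Icc 1 n).filter fun q => (q < i ∧ w q < w i) ∨ (q < j ∧ w q < w j)).card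
      + 1 ≤ k) : Goal321 n k w := by
  obtain ⟨M, hM, hA⟩ := profA w hf i k hik
  obtain ⟨N, hN, hT⟩ := profT w hf j k hkj
  have goR := FR n k w hf i j h1 hik hkj hjn (by omega) hU M hM
  have goL := FL n k w hf i j h1 hik hkj hjn (by omega) hD N hN
  have useL : ∀ p y r, i ≤ p → p < y → y ≤ k → w i ≤ w y → w y < w p → LI w k p r → r < N →
      Goal321 n k w := by
    intro p y r a1 a2 a3 a4 a5 a6 a7
    obtain ⟨t, b1, b2, b3, b4⟩ := hN r a7
    exact ⟨p, y, t, r, by omega, by omega, by omega, by omega, by omega, by omega, by omega,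
      by omega, a6, b4⟩
  have useR : ∀ p y r, p ≤ j → y < p → k < y → w y ≤ w j → w p < w y → RI w k p r → r < M →
      Goal321 n k w := by
    intro p y r a1 a2 a3 a4 a5 a6 a7
    obtain ⟨t, b1, b2, b3, b4⟩ := hM r a7
    exact ⟨t, y, p, r, by omega, by omega, by omega, by omega, by omega, by omega, by omega,
      by omega, b4, a6⟩
  rcases hA with ⟨l, hl, hl2⟩ | ⟨p, y, l, a1, a2, a3, a4, a5, a6, a7, a8⟩ <;>
  rcases hT with ⟨r, hr, hr2⟩ | ⟨p', y', r, b1, b2, b3, b4, b5, b6, b7, b8⟩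
  · rcases lt_trichotomy l r with h | h | h
    · exact goL l (by omega) hl2 (by rw [hr2.1]; exact h)
    · subst h
      exact ⟨i, m, j, l, h1, him, hmj, hjn, hw1, hw2, hik, hkj, hl2, hr2⟩
    · exact goR r (by omega) hr2 (by rw [hl2.1]; exact h)
  · by_cases h : r < M
    · exact useR p' y' r b1 b2 b3 b4 b5 b6 h
    · exact goL l (by omega) hl2 (by omega)
  · by_cases h : l < N
    · exact useL p y l a1 a2 a3 a4 a5 a6 h
    · exact goR r (by omega) hr2 (by omega)
  · by_cases h : l < N
    · exact useL p y l a1 a2 a3 a4 a5 a6 h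
    · exact useR p' y' r b1 b2 b3 b4 b5 b6 (by omega)

/-- all three positions on the left -/
theorem leftCase (n k : ℕ) (w : ℕ → ℕ) (hf : Function.Injective w) (i m j : ℕ) (h1 : 1 ≤ i)
    (hjk : j ≤ k) (hkn : k ≤ n) (him : i < m) (hmj : m < j)
    (hw1 : w j < w m) (hw2 : w m < w i)
    (hU : ((Finset.Icc 1 n).filter fun q => (i < q ∧ w i < w q) ∨ (j < q ∧ w j < w q)).card
      + k + 1 ≤ n) : Goal321 n k w := by
  obtain ⟨M, hM, hA⟩ := profA w hf i k (by omega)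
  set L := (Finset.Ioc i k).filter fun q => w i < w q with hL
  set T := (Finset.Ioc k n).filter fun q => w q < w j with hT
  have memTT : ∀ t, t ∈ T ↔ k < t ∧ t ≤ n ∧ w t < w j := by
    intro t; simp only [hT, Finset.mem_filter, Finset.mem_Ioc, and_assoc]
  have hcard : L.card < T.card := by
    have hsub : T ⊆ Finset.Ioc k n := Finset.filter_subset _ _
    have hc := Finset.card_sdiff_of_subset hsub
    have hc' := Finset.card_le_card hsub
    rw [Nat.card_Ioc] at hc hc'
    have hd : Disjoint L (Finset.Ioc k n \ T) := by
      rw [Finset.disjoint_left]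
      intro q hq hq2
      simp only [hL, Finset.mem_filter, Finset.mem_Ioc] at hq
      simp only [Finset.mem_sdiff, Finset.mem_Ioc] at hq2
      omega
    have hs : L ∪ (Finset.Ioc k n \ T) ⊆
        (Finset.Icc 1 n).filter fun q => (i < q ∧ w i < w q) ∨ (j < q ∧ w j < w q) := by
      intro q hq
      rw [Finset.mem_filter, Finset.mem_Icc]
      rw [Finset.mem_union] at hq
      rcases hq with hq | hq
      · simp only [hL, Finset.mem_filter, Finset.mem_Ioc] at hq
        omega
      · rw [Finset.mem_sdiff, memTT, Finset.mem_Ioc] at hq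
        have n1 : w q ≠ w j := fun h => by have := hf h; omega
        omega
    have := Finset.card_le_card hs
    rw [Finset.card_union_of_disjoint hd, hc] at this
    omega
  obtain ⟨N, hN, hT'⟩ := profR w hf k T (by
    intro t ht
    rw [memTT] at ht
    refine ⟨ht.1, fun q a b c => (memTT q).2 ⟨a, by omega, by omega⟩⟩)
  have useL : ∀ p y r, i ≤ p → p < y → y ≤ k → w j ≤ w y → w y < w p → LI w k p r → r < N →
      Goal321 n k w := by
    intro p y r a1 a2 a3 a4 a5 a6 a7
    obtain ⟨t, b1, b4⟩ := hN r a7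
    rw [memTT] at b1
    exact ⟨p, y, t, r, by omega, by omega, by omega, by omega, by omega, by omega, by omega,
      by omega, a6, b4⟩
  have useR : ∀ p y r, p ≤ n → y < p → k < y → w y ≤ w j → w p < w y → RI w k p r → r < M →
      Goal321 n k w := by
    intro p y r a1 a2 a3 a4 a5 a6 a7
    obtain ⟨t, b1, b2, b3, b4⟩ := hM r a7
    exact ⟨t, y, p, r, by omega, by omega, by omega, by omega, by omega, by omega, by omega,
      by omega, b4, a6⟩
  have hA' : ∃ p y l, i ≤ p ∧ p < y ∧ y ≤ k ∧ w j ≤ w y ∧ w y < w p ∧ LI w k p l ∧ l < M ∧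
      l ≤ L.card := by
    rcases hA with ⟨l, hl, hl2⟩ | ⟨p, y, l, a1, a2, a3, a4, a5, a6, a7, a8⟩
    · exact ⟨i, m, l, le_rfl, him, by omega, by omega, hw2, hl2, by omega, le_of_eq hl2.1.symm⟩
    · exact ⟨p, y, l, a1, a2, a3, by omega, a5, a6, a7, a8⟩
  obtain ⟨p, y, l, a1, a2, a3, a4, a5, a6, a7, a8⟩ := hA'
  by_cases h : l < N
  · exact useL p y l a1 a2 a3 a4 a5 a6 h
  · rcases hT' with ⟨h1, h2⟩ | ⟨q, hq, y', hy', hpy, hw, r, hr, hrM⟩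
    · omega
    · rw [memTT] at hq hy'
      exact useR q y' r (by omega) hpy (by omega) (by omega) hw hr (by omega)

/-- all three positions on the right -/
theorem rightCase (n k : ℕ) (w : ℕ → ℕ) (hf : Function.Injective w) (i m j : ℕ)
    (hki : k < i) (hjn : j ≤ n) (him : i < m) (hmj : m < j)
    (hw1 : w j < w m) (hw2 : w m < w i)
    (hD : ((Finset.Icc 1 n).filter fun q => (q < i ∧ w q < w i) ∨ (q < j ∧ w q < w j)).card
      + 1 ≤ k) : Goal321 n k w := by
  obtain ⟨N, hN, hA⟩ := profT w hf j k (by omega)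
  set R := (Finset.Ioo k j).filter fun q => w q < w j with hR
  set T := (Finset.Icc 1 k).filter fun q => w i < w q with hT
  have memTT : ∀ t, t ∈ T ↔ 1 ≤ t ∧ t ≤ k ∧ w i < w t := by
    intro t; simp only [hT, Finset.mem_filter, Finset.mem_Icc, and_assoc]
  have hcard : R.card < T.card := by
    have hsub : T ⊆ Finset.Icc 1 k := Finset.filter_subset _ _
    have hc := Finset.card_sdiff_of_subset hsub
    have hc' := Finset.card_le_card hsub
    rw [Nat.card_Icc] at hc hc'
    have hd : Disjoint R (Finset.Icc 1 k \ T) := by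
      rw [Finset.disjoint_left]
      intro q hq hq2
      simp only [hR, Finset.mem_filter, Finset.mem_Ioo] at hq
      simp only [Finset.mem_sdiff, Finset.mem_Icc] at hq2
      omega
    have hs : R ∪ (Finset.Icc 1 k \ T) ⊆
        (Finset.Icc 1 n).filter fun q => (q < i ∧ w q < w i) ∨ (q < j ∧ w q < w j) := by
      intro q hq
      rw [Finset.mem_filter, Finset.mem_Icc]
      rw [Finset.mem_union] at hq
      rcases hq with hq | hq
      · simp only [hR, Finset.mem_filter, Finset.mem_Ioo] at hq
        omega
      · rw [Finset.mem_sdiff, memTT, Finset.mem_Icc] at hq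
        have n1 : w q ≠ w i := fun h => by have := hf h; omega
        omega
    have := Finset.card_le_card hs
    rw [Finset.card_union_of_disjoint hd, hc] at this
    omega
  obtain ⟨M, hM, hT'⟩ := profL w hf k T (by
    intro t ht
    rw [memTT] at ht
    refine ⟨ht.2.1, fun q a b c => (memTT q).2 ⟨by omega, by omega, by omega⟩⟩)
  have useR : ∀ p y r, p ≤ j → y < p → k < y → w y ≤ w i → w p < w y → RI w k p r → r < M →
      Goal321 n k w := by
    intro p y r a1 a2 a3 a4 a5 a6 a7
    obtain ⟨t, b1, b4⟩ := hM r a7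
    rw [memTT] at b1
    exact ⟨t, y, p, r, by omega, by omega, by omega, by omega, by omega, by omega, by omega,
      by omega, b4, a6⟩
  have useL : ∀ p y r, 1 ≤ p → p < y → y ≤ k → w i ≤ w y → w y < w p → LI w k p r → r < N →
      Goal321 n k w := by
    intro p y r a1 a2 a3 a4 a5 a6 a7
    obtain ⟨t, b1, b2, b3, b4⟩ := hN r a7
    exact ⟨p, y, t, r, by omega, by omega, by omega, by omega, by omega, by omega, by omega,
      by omega, a6, b4⟩
  have hA' : ∃ p y l, p ≤ j ∧ y < p ∧ k < y ∧ w y ≤ w i ∧ w p < w y ∧ RI w k p l ∧ l < N ∧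
      l ≤ R.card := by
    rcases hA with ⟨l, hl, hl2⟩ | ⟨p, y, l, a1, a2, a3, a4, a5, a6, a7, a8⟩
    · exact ⟨j, m, l, le_rfl, hmj, by omega, by omega, hw1, hl2, by omega, le_of_eq hl2.1.symm⟩
    · exact ⟨p, y, l, a1, a2, a3, by omega, a5, a6, a7, a8⟩
  obtain ⟨p, y, l, a1, a2, a3, a4, a5, a6, a7, a8⟩ := hA'
  by_cases h : l < M
  · exact useR p y l a1 a2 a3 a4 a5 a6 h
  · rcases hT' with ⟨h1, h2⟩ | ⟨q, hq, y', hy', hpy, hw, r, hr, hrM⟩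
    · omega
    · rw [memTT] at hq hy'
      exact useL q y' r (by omega) hpy (by omega) (by omega) hw hr (by omega)

theorem sr_apply (p x : ℕ) : simpleRefl p x = if x = p then p + 1 else if x = p + 1 then p else x := by
  rw [simpleRefl, Equiv.swap_apply_def]

theorem sr_sq (p : ℕ) : simpleRefl p * simpleRefl p = 1 := Equiv.swap_mul_self _ _

theorem isPerm_mul (n : ℕ) (w : Equiv.Perm ℕ) (hw : IsPermOf n w) (p : ℕ) (h1 : 1 ≤ p)
    (h2 : p ≤ n - 1) : IsPermOf n (w * simpleRefl p) := by
  intro x hx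
  rw [Equiv.Perm.mul_apply]
  have : simpleRefl p x = x := by
    rw [Finset.mem_Icc] at hx
    rw [sr_apply]
    split_ifs <;> omega
  rw [this, hw x hx]

theorem isPerm_mem (n : ℕ) (w : Equiv.Perm ℕ) (hw : IsPermOf n w) (x : ℕ) (h1 : 1 ≤ x)
    (h2 : x ≤ n) : 1 ≤ w x ∧ w x ≤ n := by
  by_contra h
  have h3 : w x ∉ Finset.Icc 1 n := by rw [Finset.mem_Icc]; exact h
  have := w.injective (hw _ h3)
  omega

theorem len_desc (n : ℕ) (w : Equiv.Perm ℕ) (p : ℕ) (h1 : 1 ≤ p)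
    (h2 : p ≤ n - 1) (hd : w (p + 1) < w p) : len n (w * simpleRefl p) + 1 = len n w := by
  unfold len
  set I := (Finset.Icc 1 n ×ˢ Finset.Icc 1 n).filter fun p => p.1 < p.2 ∧ w p.2 < w p.1 with hI
  have hmem : (p, p + 1) ∈ I := by
    simp only [hI, Finset.mem_filter, Finset.mem_product, Finset.mem_Icc]
    omega
  rw [← Finset.card_erase_add_one hmem]
  congr 1
  refine Finset.card_bij' (fun x _ => (simpleRefl p x.1, simpleRefl p x.2))
    (fun x _ => (simpleRefl p x.1, simpleRefl p x.2)) ?_ ?_ ?_ ?_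
  · rintro ⟨x, y⟩ h
    rw [Finset.mem_filter] at h
    rw [Finset.mem_erase, Finset.mem_filter]
    simp only [Finset.mem_product, Finset.mem_Icc,
      Equiv.Perm.mul_apply, ne_eq, Prod.mk.injEq] at h ⊢
    obtain ⟨h3, h4, h5⟩ := h
    refine ⟨?_, ?_, ?_, h5⟩ 
    · intro h
      rw [sr_apply, sr_apply] at h
      split_ifs at h <;> omega
    · rw [sr_apply, sr_apply]; split_ifs <;> omega
    · have : ¬ (x = p ∧ y = p + 1) := by
        rintro ⟨rfl, rfl⟩
        simp [sr_apply] at h5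
        omega
      rw [sr_apply, sr_apply]; split_ifs <;> omega
  · rintro ⟨x, y⟩ h
    rw [Finset.mem_erase, Finset.mem_filter] at h
    rw [Finset.mem_filter]
    simp only [Finset.mem_product, Finset.mem_Icc,
      Equiv.Perm.mul_apply, ne_eq, Prod.mk.injEq] at h ⊢
    obtain ⟨h3, h4, h5, h6⟩ := h
    have e : ∀ z, simpleRefl p (simpleRefl p z) = z := fun z => by
      rw [← Equiv.Perm.mul_apply, sr_sq]; rfl
    refine ⟨?_, ?_, by rw [e, e]; exact h6⟩
    · rw [sr_apply, sr_apply]; split_ifs <;> omega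
    · rw [sr_apply, sr_apply]; split_ifs <;> omega
  · rintro ⟨x, y⟩ _
    simp [← Equiv.Perm.mul_apply, sr_sq]
  · rintro ⟨x, y⟩ _
    simp [← Equiv.Perm.mul_apply, sr_sq]

theorem sr_self (p : ℕ) : simpleRefl p p = p + 1 := by simp [sr_apply]
theorem sr_succ (p : ℕ) : simpleRefl p (p + 1) = p := by simp [sr_apply]

theorem len_asc (n : ℕ) (w : Equiv.Perm ℕ) (p : ℕ) (h1 : 1 ≤ p)
    (h2 : p ≤ n - 1) (hd : w p < w (p + 1)) : len n (w * simpleRefl p) = len n w + 1 := by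
  have := len_desc n (w * simpleRefl p) p h1 h2 (by simpa [sr_self, sr_succ] using hd)
  rw [mul_assoc, sr_sq, mul_one] at this
  exact this.symm

theorem len_one (n : ℕ) : len n 1 = 0 := by
  unfold len
  rw [Finset.card_eq_zero, Finset.filter_eq_empty_iff]
  rintro ⟨x, y⟩ _
  simp only [Equiv.Perm.one_apply]
  omega

theorem w_ne (w : Equiv.Perm ℕ) (p : ℕ) : w p ≠ w (p + 1) := fun h => by
  have := w.injective h; omega

theorem len_le (n : ℕ) (L : List ℕ) : ∀ w, IsWord n w L → len n w ≤ L.length := by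
  induction L using List.reverseRecOn with
  | nil =>
    rintro w ⟨_, h⟩
    simp only [List.map_nil, List.prod_nil] at h
    rw [← h, len_one]; simp
  | append_singleton L p ih =>
    rintro w ⟨h1, h⟩
    have hp := h1 p (by simp)
    simp only [List.map_append, List.prod_append, List.map_cons, List.map_nil, List.prod_cons,
      List.prod_nil, mul_one] at h
    have := ih _ ⟨fun i hi => h1 i (by simp [hi]), rfl⟩
    rw [List.length_append, List.length_singleton]
    rcases lt_or_gt_of_ne (w_ne (List.map simpleRefl L).prod p) with h' | h'
    · have := len_asc n _ p hp.1 hp.2 h'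
      rw [h] at this; omega
    · have := len_desc n _ p hp.1 hp.2 h'
      rw [h] at this; omega

theorem red_snoc (n : ℕ) (w : Equiv.Perm ℕ) (L : List ℕ) (p : ℕ)
    (h : IsReducedWord n w (L ++ [p])) :
    1 ≤ p ∧ p ≤ n - 1 ∧ w (p + 1) < w p ∧ IsReducedWord n (w * simpleRefl p) L := by
  obtain ⟨⟨h1, h2⟩, h3⟩ := h
  have hp := h1 p (by simp)
  simp only [List.map_append, List.prod_append, List.map_cons, List.map_nil, List.prod_cons,
      List.prod_nil, mul_one] at h2
  have hW : IsWord n (w * simpleRefl p) L := by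
    refine ⟨fun i hi => h1 i (by simp [hi]), ?_⟩
    rw [← h2, mul_assoc, sr_sq, mul_one]
  have hl := len_le n L _ hW
  rw [List.length_append, List.length_singleton] at h3
  have hd : w (p + 1) < w p := by
    rcases lt_or_gt_of_ne (w_ne w p) with h' | h'
    · have := len_asc n _ p hp.1 hp.2 h'
      omega
    · exact h'
  refine ⟨hp.1, hp.2, hd, hW, ?_⟩
  have := len_desc n _ p hp.1 hp.2 hd
  omega

theorem snoc_red (n : ℕ) (w : Equiv.Perm ℕ) (L : List ℕ) (p : ℕ) (h1 : 1 ≤ p)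
    (h2 : p ≤ n - 1) (hd : w (p + 1) < w p) (h : IsReducedWord n (w * simpleRefl p) L) :
    IsReducedWord n w (L ++ [p]) := by
  obtain ⟨⟨a1, a2⟩, a3⟩ := h
  refine ⟨⟨?_, ?_⟩, ?_⟩
  · intro i hi
    rw [List.mem_append, List.mem_singleton] at hi
    rcases hi with hi | rfl
    · exact a1 i hi
    · exact ⟨h1, h2⟩
  · simp only [List.map_append, List.prod_append, List.map_cons, List.map_nil, List.prod_cons,
      List.prod_nil, mul_one]
    rw [a2, mul_assoc, sr_sq, mul_one]
  · rw [List.length_append, List.length_singleton, a3]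
    exact len_desc n _ p h1 h2 hd

theorem eq_one_of_no_desc (n : ℕ) (w : Equiv.Perm ℕ) (hw : IsPermOf n w)
    (h : ∀ p, 1 ≤ p → p ≤ n - 1 → w p < w (p + 1)) : w = 1 := by
  have hm : StrictMono w := by
    apply strictMono_nat_of_lt_succ
    intro x
    by_cases h1 : 1 ≤ x ∧ x ≤ n - 1
    · exact h x h1.1 h1.2
    · have h0 : w 0 = 0 := hw 0 (by simp)
      by_cases hx : x = 0
      · subst hx
        rw [h0]
        have : w 0 ≠ w (0 + 1) := w_ne w 0
        omega
      · have e : w (x + 1) = x + 1 := hw _ (by rw [Finset.mem_Icc]; omega)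
        by_cases hxn : x ≤ n
        · have := isPerm_mem n w hw x (by omega) hxn
          omega
        · have : w x = x := hw _ (by rw [Finset.mem_Icc]; omega)
          omega
  have hm2 : StrictMono w.symm := by
    intro x y hxy
    by_contra hh
    have := hm.monotone (not_lt.1 hh)
    simp at this
    omega
  ext x
  have a := hm.id_le x
  have b := hm2.id_le (w x)
  simp at a b
  simp
  omega

theorem red_exists (n : ℕ) : ∀ l, ∀ w, IsPermOf n w → len n w = l →
    ∃ L, IsReducedWord n w L := by
  intro l
  induction l with
  | zero =>
    intro w hw hl
    have : w = 1 := by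
      apply eq_one_of_no_desc n w hw
      intro p h1 h2
      rcases lt_or_gt_of_ne (w_ne w p) with h' | h'
      · exact h'
      · have := len_desc n _ p h1 h2 h'
        omega
    refine ⟨[], ⟨by simp, by simp [this]⟩, by simp [hl]⟩
  | succ l ih =>
    intro w hw hl
    by_cases h : ∀ p, 1 ≤ p → p ≤ n - 1 → w p < w (p + 1)
    · rw [eq_one_of_no_desc n w hw h, len_one] at hl
      omega
    · push Not at h
      obtain ⟨p, h1, h2, h3⟩ := h
      have hd := lt_of_le_of_ne h3 (w_ne w p).symm
      have hl2 := len_desc n _ p h1 h2 hd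
      obtain ⟨L, hL⟩ := ih _ (isPerm_mul n w hw p h1 h2) (by omega)
      exact ⟨_, snoc_red n w L p h1 h2 hd hL⟩

inductive WLe (n : ℕ) : Equiv.Perm ℕ → Equiv.Perm ℕ → Prop
  | refl (w) : WLe n w w
  | step (w w' p) : 1 ≤ p → p ≤ n - 1 → w (p + 1) < w p → WLe n (w * simpleRefl p) w' → WLe n w w'

def Bad (n k : ℕ) (w : Equiv.Perm ℕ) : Prop :=
  ∃ t, (t = k ∨ t + 1 = k) ∧ 1 ≤ t ∧ t + 2 ≤ n ∧ w (t + 1) < w t ∧ w (t + 2) < w (t + 1)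

theorem wle_perm (n : ℕ) (w w' : Equiv.Perm ℕ) (h : WLe n w w') (hw : IsPermOf n w) :
    IsPermOf n w' := by
  induction h with
  | refl w => exact hw
  | step w w' p h1 h2 h3 _ ih => exact ih (isPerm_mul n w hw p h1 h2)

theorem wle_ext (n : ℕ) (w w' : Equiv.Perm ℕ) (h : WLe n w w') :
    ∃ V, ∀ L, IsReducedWord n w' L → IsReducedWord n w (L ++ V) := by
  induction h with
  | refl w => exact ⟨[], by simp⟩
  | step w w' p h1 h2 h3 _ ih =>
    obtain ⟨V, hV⟩ := ih
    refine ⟨V ++ [p], fun L hL => ?_⟩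
    rw [← List.append_assoc]
    exact snoc_red n w _ p h1 h2 h3 (hV L hL)

theorem wle_noninv (n : ℕ) (w w' : Equiv.Perm ℕ) (h : WLe n w w') :
    ∀ x y, x < y → w.symm x < w.symm y → w'.symm x < w'.symm y := by
  induction h with
  | refl w => exact fun _ _ _ h => h
  | step w w' p h1 h2 h3 _ ih =>
    intro x y hxy h
    apply ih x y hxy
    have e : ∀ z, (w * simpleRefl p).symm z = simpleRefl p (w.symm z) := by
      intro z
      rw [Equiv.symm_apply_eq, Equiv.Perm.mul_apply, ← Equiv.Perm.mul_apply (simpleRefl p), sr_sq]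
      simp
    rw [e, e]
    have : ¬ (w.symm x = p ∧ w.symm y = p + 1) := by
      rintro ⟨a, b⟩
      have h4 : w (w.symm y) < w (w.symm x) := by rw [a, b]; exact h3
      simp at h4
      omega
    rw [sr_apply, sr_apply]
    split_ifs <;> omega

theorem sr_comm (p q : ℕ) (h : p + 2 ≤ q) :
    simpleRefl p * simpleRefl q = simpleRefl q * simpleRefl p := by
  ext x
  simp only [Equiv.Perm.mul_apply, sr_apply]
  split_ifs <;> omega

theorem sr_braid (p : ℕ) :
    simpleRefl p * simpleRefl (p + 1) * simpleRefl p =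
      simpleRefl (p + 1) * simpleRefl p * simpleRefl (p + 1) := by
  ext x
  simp only [Equiv.Perm.mul_apply, sr_apply]
  split_ifs <;> omega

/-- the two reduced words coming from a `321` at consecutive positions -/
theorem braid_words (n : ℕ) (w : Equiv.Perm ℕ) (hw : IsPermOf n w) (p : ℕ) (h1 : 1 ≤ p)
    (h2 : p + 2 ≤ n) (hd1 : w (p + 1) < w p) (hd2 : w (p + 2) < w (p + 1)) :
    ∃ N, IsReducedWord n (w * simpleRefl p) (N ++ [p] ++ [p + 1]) ∧
      IsReducedWord n (w * simpleRefl (p + 1)) (N ++ [p + 1] ++ [p]) := by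
  have hd3 : w (p + 1 + 1) < w (p + 1) := hd2
  have P1 := isPerm_mul n w hw p h1 (by omega)
  have P2 := isPerm_mul n _ P1 (p + 1) (by omega) (by omega)
  have P3 := isPerm_mul n _ P2 p (by omega) (by omega)
  obtain ⟨N, hN⟩ := red_exists n _ _ P3 rfl
  refine ⟨N, ?_, ?_⟩
  · apply snoc_red n _ _ _ (by omega) (by omega)
    · simp only [Equiv.Perm.mul_apply, sr_apply]
      split_ifs <;> omega
    apply snoc_red n _ _ _ (by omega) (by omega)
    · simp only [Equiv.Perm.mul_apply, sr_apply]
      split_ifs <;> omega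
    exact hN
  · apply snoc_red n _ _ _ (by omega) (by omega)
    · simp only [Equiv.Perm.mul_apply, sr_apply]
      split_ifs <;> omega
    apply snoc_red n _ _ _ (by omega) (by omega)
    · simp only [Equiv.Perm.mul_apply, sr_apply]
      split_ifs <;> omega
    rw [mul_assoc, mul_assoc, ← mul_assoc (simpleRefl (p + 1)), ← sr_braid]
    simpa only [mul_assoc] using hN

theorem far_words (n : ℕ) (w : Equiv.Perm ℕ) (hw : IsPermOf n w) (p q : ℕ) (h1 : 1 ≤ p)
    (h2 : p + 2 ≤ q) (hq : q ≤ n - 1) (hd1 : w (p + 1) < w p) (hd2 : w (q + 1) < w q) :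
    ∃ N, IsReducedWord n (w * simpleRefl p) (N ++ [q]) ∧
      IsReducedWord n (w * simpleRefl q) (N ++ [p]) := by
  have P1 := isPerm_mul n w hw p h1 (by omega)
  have P2 := isPerm_mul n _ P1 q (by omega) (by omega)
  obtain ⟨N, hN⟩ := red_exists n _ _ P2 rfl
  refine ⟨N, ?_, ?_⟩
  · apply snoc_red n _ _ _ (by omega) (by omega)
    · simp only [Equiv.Perm.mul_apply, sr_apply]
      split_ifs <;> omega
    exact hN
  · apply snoc_red n _ _ _ (by omega) (by omega)
    · simp only [Equiv.Perm.mul_apply, sr_apply]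
      split_ifs <;> omega
    rw [mul_assoc, ← sr_comm p q h2, ← mul_assoc]
    exact hN

theorem count_const (n k : ℕ) : ∀ l, ∀ w, len n w = l → IsPermOf n w →
    (∀ w', WLe n w w' → ¬ Bad n k w') → ∀ L1 L2, IsReducedWord n w L1 → IsReducedWord n w L2 →
    L1.count k = L2.count k := by
  intro l
  induction l with
  | zero =>
    intro w hl _ _ L1 L2 h1 h2
    have e1 := h1.2
    have e2 := h2.2
    rw [hl, List.length_eq_zero_iff] at e1 e2
    rw [e1, e2]
  | succ l ih =>
    intro w hl hw hB L1 L2 h1 h2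
    have main : ∀ p q M1 M2, p ≤ q → IsReducedWord n w (M1 ++ [p]) → IsReducedWord n w (M2 ++ [q]) →
        (M1 ++ [p]).count k = (M2 ++ [q]).count k := by
      intro p q M1 M2 hpq h1 h2
      obtain ⟨p1, p2, p3, p4⟩ := red_snoc n w M1 p h1
      obtain ⟨q1, q2, q3, q4⟩ := red_snoc n w M2 q h2
      have ihp := ih _ (by have := len_desc n w p p1 p2 p3; omega) (isPerm_mul n w hw p p1 p2)
        (fun w' h => hB w' (WLe.step w w' p p1 p2 p3 h))
      have ihq := ih _ (by have := len_desc n w q q1 q2 q3; omega) (isPerm_mul n w hw q q1 q2)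
        (fun w' h => hB w' (WLe.step w w' q q1 q2 q3 h))
      by_cases e : p = q
      · subst e
        rw [List.count_append, List.count_append, ihp M1 M2 p4 q4]
      by_cases e2 : q = p + 1
      · subst e2
        have hk : k ≠ p ∧ k ≠ p + 1 := by
          constructor
          · rintro rfl
            exact hB w (WLe.refl w) ⟨k, Or.inl rfl, by omega, by omega, p3, q3⟩
          · rintro rfl
            exact hB w (WLe.refl w) ⟨p, Or.inr rfl, by omega, by omega, p3, q3⟩
        obtain ⟨N, n1, n2⟩ := braid_words n w hw p p1 (by omega) p3 q3
        have a := ihp M1 _ p4 n1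
        have b := ihq M2 _ q4 n2
        have k1 := hk.1.symm
        have k2 := hk.2.symm
        simp [List.count_append, a, b, k1, k2]
      · obtain ⟨N, n1, n2⟩ := far_words n w hw p q p1 (by omega) q2 p3 q3
        have a := ihp M1 _ p4 n1
        have b := ihq M2 _ q4 n2
        simp only [List.count_append, a, b]
        omega
    have ne : ∀ L, IsReducedWord n w L → ∃ M p, L = M ++ [p] := by
      intro L hL
      rcases List.eq_nil_or_concat L with h | ⟨M, p, h⟩
      · have := hL.2
        rw [h, hl] at this
        simp at this
      · exact ⟨M, p, by simpa using h⟩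
    obtain ⟨M1, p, rfl⟩ := ne L1 h1
    obtain ⟨M2, q, rfl⟩ := ne L2 h2
    rcases le_total p q with h | h
    · exact main p q M1 M2 h h1 h2
    · exact (main q p M2 M1 h h2 h1).symm

theorem bad_words (n k : ℕ) (w : Equiv.Perm ℕ) (hw : IsPermOf n w) (h : Bad n k w) :
    ∃ L1 L2, IsReducedWord n w L1 ∧ IsReducedWord n w L2 ∧ L1.count k < L2.count k := by
  obtain ⟨t, ht, h1, h2, h3, h4⟩ := h
  obtain ⟨N, n1, n2⟩ := braid_words n w hw t h1 h2 h3 h4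
  have m1 := snoc_red n w _ t h1 (by omega) h3 n1
  have m2 := snoc_red n w _ (t + 1) (by omega) (by omega) h4 n2
  rcases ht with rfl | rfl
  · refine ⟨_, _, m2, m1, ?_⟩
    simp [List.count_append]
  · refine ⟨_, _, m1, m2, ?_⟩
    simp [List.count_append]

theorem min_lt_max_iff (n k : ℕ) (w : Equiv.Perm ℕ) (hw : IsPermOf n w) :
    minOcc n k w < maxOcc n k w ↔ ∃ w', WLe n w w' ∧ Bad n k w' := by
  have hbdd : BddAbove {m | ∃ L : List ℕ, IsReducedWord n w L ∧ L.count k = m} := by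
    refine ⟨len n w, ?_⟩
    rintro m ⟨L, hL, rfl⟩
    rw [← hL.2]
    exact List.count_le_length
  obtain ⟨L0, hL0⟩ := red_exists n _ w hw rfl
  have hne : {m | ∃ L : List ℕ, IsReducedWord n w L ∧ L.count k = m}.Nonempty := ⟨_, L0, hL0, rfl⟩
  constructor
  · intro h
    by_contra hcon
    push Not at hcon
    obtain ⟨L1, a1, a2⟩ := Nat.sInf_mem hne
    obtain ⟨L2, b1, b2⟩ := Nat.sSup_mem hne hbdd
    have := count_const n k _ w rfl hw hcon L1 L2 a1 b1
    unfold minOcc maxOcc at h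
    omega
  · rintro ⟨w', h1, h2⟩
    obtain ⟨L1, L2, a, b, c⟩ := bad_words n k w' (wle_perm n w w' h1 hw) h2
    obtain ⟨V, hV⟩ := wle_ext n w w' h1
    have d1 : minOcc n k w ≤ (L1 ++ V).count k := Nat.sInf_le ⟨_, hV _ a, rfl⟩
    have d2 : (L2 ++ V).count k ≤ maxOcc n k w := le_csSup hbdd ⟨_, hV _ b, rfl⟩
    rw [List.count_append] at d1 d2
    omega

theorem sort_exists (n : ℕ) (g : ℕ → ℕ) : ∀ l, ∀ w : Equiv.Perm ℕ, len n w = l →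
    (∀ p q, 1 ≤ p → p < q → q ≤ n → w p < w q → g (w p) ≤ g (w q)) →
    ∃ w', WLe n w w' ∧ ∀ p q, 1 ≤ p → p ≤ q → q ≤ n → g (w' p) ≤ g (w' q) := by
  intro l
  induction l using Nat.strong_induction_on with
  | _ l ih =>
    intro w hl hg
    by_cases h : ∃ p, 1 ≤ p ∧ p ≤ n - 1 ∧ g (w (p + 1)) < g (w p)
    · obtain ⟨p, h1, h2, h3⟩ := h
      have hd : w (p + 1) < w p := by
        by_contra hh
        have := hg p (p + 1) h1 (by omega) (by omega) (lt_of_le_of_ne (not_lt.1 hh) (w_ne w p))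
        omega
      have hl2 := len_desc n w p h1 h2 hd
      obtain ⟨w', a, b⟩ := ih _ (by omega) (w * simpleRefl p) rfl (by
        intro x y hx hxy hy hw
        rw [Equiv.Perm.mul_apply, Equiv.Perm.mul_apply] at hw ⊢
        by_cases e : x = p ∧ y = p + 1
        · rw [e.1, e.2, sr_self, sr_succ]
          exact le_of_lt h3
        · apply hg _ _ _ _ _ hw
          · rw [sr_apply]; split_ifs <;> omega
          · rw [sr_apply, sr_apply]; split_ifs <;> omega
          · rw [sr_apply]; split_ifs <;> omega)
      exact ⟨w', WLe.step w w' p h1 h2 hd a, b⟩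
    · push Not at h
      refine ⟨w, WLe.refl w, ?_⟩
      intro p q hp hpq
      induction q, hpq using Nat.le_induction with
      | base => exact fun _ => le_rfl
      | succ q hq ih2 =>
        intro hn
        exact le_trans (ih2 (by omega)) (h q (by omega) (by omega))

theorem isPerm_symm (n : ℕ) (w : Equiv.Perm ℕ) (hw : IsPermOf n w) : IsPermOf n w.symm := by
  intro x hx
  rw [Equiv.symm_apply_eq, hw x hx]

theorem exG (D : Finset ℕ) (i m j : ℕ) (h1 : i ≠ m) (h2 : m ≠ j) (h3 : i ≠ j)
    (hi : i ∉ D) (hm : m ∉ D) (hj : j ∉ D) :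
    ∃ G : ℕ → ℕ, (∀ q, q ∈ D ↔ G q = 0) ∧ G i = 1 ∧ G m = 2 ∧ G j = 3 ∧
      (∀ q, G q = 1 → q = i) ∧ (∀ q, G q = 2 → q = m) ∧ (∀ q, G q = 3 → q = j) ∧
      (∀ q, G q ≤ 4) := by
  refine ⟨fun q => if q ∈ D then 0 else if q = i then 1 else if q = m then 2 else
    if q = j then 3 else 4, ?_, ?_, ?_, ?_, ?_, ?_, ?_, ?_⟩
  · intro q
    by_cases h : q ∈ D
    · simp [h]
    · simp only [h, if_false, false_iff]
      split_ifs <;> simp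
  · simp [hi]
  · simp [hm, h1.symm]
  · simp [hj, h2.symm, h3.symm]
  · intro q h
    dsimp only at h
    split_ifs at h <;> first | assumption | omega
  · intro q h
    dsimp only at h
    split_ifs at h <;> first | assumption | omega
  · intro q h
    dsimp only at h
    split_ifs at h <;> first | assumption | omega
  · intro q
    dsimp only
    split_ifs <;> omega

theorem block (n : ℕ) (w : Equiv.Perm ℕ) (hw : IsPermOf n w) (i m j : ℕ) (h1 : 1 ≤ i)
    (him : i < m) (hmj : m < j) (hjn : j ≤ n) (w1 : w j < w m) (w2 : w m < w i)
    (D : Finset ℕ) (hDn : ∀ q ∈ D, 1 ≤ q ∧ q ≤ n) (hi : i ∉ D) (hm : m ∉ D) (hj : j ∉ D)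
    (hD : ∀ q ∈ D, ∀ q', 1 ≤ q' → q' < q → w q' < w q → q' ∈ D)
    (hB : ∀ q, 1 ≤ q → (q < i ∧ w q < w i) ∨ (q < m ∧ w q < w m) ∨ (q < j ∧ w q < w j) → q ∈ D)
    (k : ℕ) (hk : D.card + 1 = k ∨ D.card + 2 = k) :
    ∃ w', WLe n w w' ∧ Bad n k w' := by
  classical
  obtain ⟨G, G0, Gi, Gm, Gj, G1, G2, G3, G4⟩ := exG D i m j (by omega) (by omega) (by omega) hi hm hj
  obtain ⟨w', hle, hmono⟩ := sort_exists n (fun v => G (w.symm v)) _ w rfl (by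
    intro p q hp hpq hq hwpq
    simp only [Equiv.symm_apply_apply]
    by_cases hqD : q ∈ D
    · have := hD q hqD p hp hpq hwpq
      rw [G0] at this; omega
    · by_cases hpD : p ∈ D
      · rw [G0] at hpD; omega
      · have hb := mt (hB p hp) hpD
        have c1 : G q ≠ 0 := fun h => hqD ((G0 q).2 h)
        have c2 : G q ≠ 1 := fun h => by
          have := G1 q h; subst this; omega
        have c3 : G q ≠ 2 := fun h => by
          have := G2 q h; subst this; omega
        have c4 : G q ≠ 3 := fun h => by
          have := G3 q h; subst this; omega
        have := G4 p
        omega)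
  have hw' := wle_perm n w w' hle hw
  let P : ℕ → ℕ := fun q => w'.symm (w q)
  have Pmem : ∀ q, 1 ≤ q → q ≤ n → 1 ≤ P q ∧ P q ≤ n := by
    intro q a b
    have := isPerm_mem n w hw q a b
    exact isPerm_mem n _ (isPerm_symm n w' hw') _ this.1 this.2
  have Qex : ∀ x, 1 ≤ x → x ≤ n → ∃ q, 1 ≤ q ∧ q ≤ n ∧ P q = x := by
    intro x a b
    have c := isPerm_mem n w' hw' x a b
    have d := isPerm_mem n _ (isPerm_symm n w hw) _ c.1 c.2
    exact ⟨w.symm (w' x), d.1, d.2, by simp [P]⟩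
  have Pmono : ∀ q q', 1 ≤ q → q ≤ n → 1 ≤ q' → q' ≤ n → P q ≤ P q' → G q ≤ G q' := by
    intro q q' a b c d h
    have := hmono (P q) (P q') (Pmem q a b).1 h (Pmem q' c d).2
    simpa [P] using this
  have Pinj : Function.Injective P := w'.symm.injective.comp w.injective
  have Plt : ∀ q q', 1 ≤ q → q ≤ n → 1 ≤ q' → q' ≤ n → G q < G q' → P q < P q' := by
    intro q q' a b c d h
    by_contra hh
    have := Pmono q' q c d a b (not_lt.1 hh)
    omega
  have Pim := Plt i m (by omega) (by omega) (by omega) (by omega) (by omega)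
  have Pmj := Plt m j (by omega) (by omega) (by omega) (by omega) (by omega)
  have bi := Pmem i (by omega) (by omega)
  have bj := Pmem j (by omega) (by omega)
  have em : P m = P i + 1 := by
    by_contra hne
    obtain ⟨q, q1, q2, q3⟩ := Qex (P i + 1) (by omega) (by omega)
    have a := Pmono i q (by omega) (by omega) q1 q2 (by omega)
    have b := Pmono q m q1 q2 (by omega) (by omega) (by omega)
    have : G q = 1 ∨ G q = 2 := by omega
    rcases this with h | h
    · have := G1 q h; subst this; omega
    · have := G2 q h; subst this; omega
  have ej : P j = P i + 2 := by
    by_contra hne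
    obtain ⟨q, q1, q2, q3⟩ := Qex (P i + 2) (by omega) (by omega)
    have a := Pmono m q (by omega) (by omega) q1 q2 (by omega)
    have b := Pmono q j q1 q2 (by omega) (by omega) (by omega)
    have : G q = 2 ∨ G q = 3 := by omega
    rcases this with h | h
    · have := G2 q h; subst this; omega
    · have := G3 q h; subst this; omega
  have eD : D.image P = Finset.Ico 1 (P i) := by
    ext x
    rw [Finset.mem_image, Finset.mem_Ico]
    constructor
    · rintro ⟨q, hq, rfl⟩
      obtain ⟨a, b⟩ := hDn q hq
      rw [G0] at hq
      exact ⟨(Pmem q a b).1, Plt q i a b (by omega) (by omega) (by omega)⟩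
    · rintro ⟨a, b⟩
      obtain ⟨q, q1, q2, q3⟩ := Qex x a (by omega)
      have c := Pmono q i q1 q2 (by omega) (by omega) (by omega)
      have d : G q ≠ 1 := fun h => by
        have := G1 q h; subst this; omega
      exact ⟨q, (G0 q).2 (by omega), q3⟩
  have cD : D.card = P i - 1 := by
    rw [← Finset.card_image_of_injective D Pinj, eD, Nat.card_Ico]
  have vi : w' (P i) = w i := by simp [P]
  have vm : w' (P i + 1) = w m := by rw [← em]; simp [P]
  have vj : w' (P i + 2) = w j := by rw [← ej]; simp [P]
  refine ⟨w', hle, P i, by omega, by omega, by omega, by omega, by omega⟩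

theorem backward (n k : ℕ) (w : Equiv.Perm ℕ) (hw : IsPermOf n w) (h : Goal321 n k w) :
    ∃ w', WLe n w w' ∧ Bad n k w' := by
  obtain ⟨i, m, j, l, h1, him, hmj, hjn, w1, w2, hik, hkj, hL, hR⟩ := h
  have hL := hL.1
  have hR := hR.1
  set L := (Finset.Ioc i k).filter fun q => w i < w q with hLd
  set R := (Finset.Ioo k j).filter fun q => w q < w j with hRd
  have mL : ∀ q, q ∈ insert i L ↔ q = i ∨ (i < q ∧ q ≤ k ∧ w i < w q) := by
    intro q; simp only [hLd, Finset.mem_insert, Finset.mem_filter, Finset.mem_Ioc, and_assoc]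
  have mR : ∀ q, q ∈ R ↔ k < q ∧ q < j ∧ w q < w j := by
    intro q; simp only [hRd, Finset.mem_filter, Finset.mem_Ioo, and_assoc]
  have mD : ∀ q, q ∈ (Finset.Icc 1 k \ insert i L) ∪ R ↔
      (1 ≤ q ∧ q ≤ k ∧ q ≠ i ∧ (i < q → w q < w i)) ∨ (k < q ∧ q < j ∧ w q < w j) := by
    intro q
    rw [Finset.mem_union, Finset.mem_sdiff, mL, mR, Finset.mem_Icc]
    by_cases e : q = i
    · subst e; simp
    · have : w q ≠ w i := fun h => e (w.injective h)
      constructor <;> rintro (h | h) <;> omega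
  have cD : ((Finset.Icc 1 k \ insert i L) ∪ R).card + 1 = k := by
    have hsub : insert i L ⊆ Finset.Icc 1 k := by
      intro q hq
      rw [mL] at hq
      rw [Finset.mem_Icc]; omega
    have hc' := Finset.card_le_card hsub
    rw [Finset.card_union_of_disjoint, Finset.card_sdiff_of_subset hsub]
    · rw [Finset.card_insert_of_notMem (by simp [hLd]), Nat.card_Icc] at *
      omega
    · rw [Finset.disjoint_left]
      intro q hq hq2
      rw [mR] at hq2
      rw [Finset.mem_sdiff, Finset.mem_Icc] at hq
      omega
  set D := (Finset.Icc 1 k \ insert i L) ∪ R with hDd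
  have downD : ∀ q ∈ D, ∀ q', 1 ≤ q' → q' < q → w q' < w q → q' ∈ D := by
    intro q hq q' a b c
    rw [mD] at hq ⊢
    have e : q' = i → w q' = w i := fun h => by rw [h]
    by_cases e1 : q' = i
    · subst e1; omega
    · have e2 : w q' ≠ w i := fun h => e1 (w.injective h)
      omega
  by_cases hx : ∃ x, k < x ∧ x < j ∧ w j < w x ∧ w x < w i
  · classical
    obtain ⟨a1, a2, a3, a4⟩ := Nat.find_spec hx
    have hmin := fun q (h : q < Nat.find hx) => Nat.find_min hx h
    set x := Nat.find hx with hxd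
    refine block n w hw i x j h1 (by omega) a2 hjn a3 a4 D ?_ ?_ ?_ ?_ downD ?_ k (Or.inl cD)
    · intro q hq; rw [mD] at hq; omega
    · rw [mD]; omega
    · rw [mD]; omega
    · rw [mD]; omega
    · intro q q1 hq
      rw [mD]
      have := hmin q
      by_cases e1 : q = i
      · subst e1; omega
      by_cases e2 : q = j
      · subst e2; omega
      have e3 : w q ≠ w i := fun h => e1 (w.injective h)
      have e4 : w q ≠ w j := fun h => e2 (w.injective h)
      omega
  · push Not at hx
    have hmk : m ≤ k := by
      by_contra hh
      have := hx m (by omega) hmj w1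
      omega
    obtain ⟨x, hxm, hmax⟩ := Finset.exists_max_image
      ((Finset.Ioc i k).filter fun q => w j < w q ∧ w q < w i) id
      ⟨m, by rw [Finset.mem_filter, Finset.mem_Ioc]; omega⟩
    rw [Finset.mem_filter, Finset.mem_Ioc] at hxm
    have hmax' : ∀ q, i < q → q ≤ k → w j < w q → w q < w i → q ≤ x := by
      intro q a b c d
      exact hmax q (by rw [Finset.mem_filter, Finset.mem_Ioc]; omega)
    have hxD : x ∈ D := by rw [mD]; omega
    have := Finset.card_erase_add_one hxD
    refine block n w hw i x j h1 (by omega) (by omega) hjn (by omega) (by omega) (D.erase x)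
      ?_ ?_ ?_ ?_ ?_ ?_ k (Or.inr (by omega))
    · intro q hq; rw [Finset.mem_erase, mD] at hq; omega
    · rw [Finset.mem_erase, mD]; omega
    · simp
    · rw [Finset.mem_erase, mD]; omega
    · intro q hq q' a b c
      rw [Finset.mem_erase] at hq ⊢
      refine ⟨?_, downD q hq.2 q' a b c⟩
      rintro rfl
      have hq2 := hq.2
      rw [mD] at hq2
      have := hmax' q
      omega
    · intro q q1 hq
      rw [Finset.mem_erase]
      constructor
      · rintro rfl; omega
      rcases hq with hq | hq | hq
      · rw [mD]; omega
      · exact downD x hxD q q1 hq.1 hq.2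
      · rw [mD]
        by_cases e1 : q = i
        · subst e1; omega
        omega

theorem forward (n k : ℕ) (w : Equiv.Perm ℕ) (hw : IsPermOf n w) (hk1 : 1 ≤ k) (hk2 : k + 1 ≤ n)
    (h : ∃ w', WLe n w w' ∧ Bad n k w') : Goal321 n k w := by
  obtain ⟨w', hle, t, ht, t1, t2, d1, d2⟩ := h
  have hw' := wle_perm n w w' hle hw
  have non := wle_noninv n w w' hle
  have ord : ∀ x y, w' x < w' y → y < x → w.symm (w' y) < w.symm (w' x) := by
    intro x y a b
    by_contra hh
    have hne : w.symm (w' x) ≠ w.symm (w' y) := fun h => by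
      have := w'.injective (w.symm.injective h); omega
    have := non _ _ a (by omega)
    simp at this
    omega
  have him := ord (t + 1) t d1 (by omega)
  have hmj := ord (t + 2) (t + 1) d2 (by omega)
  have mem : ∀ x, 1 ≤ x → x ≤ n → 1 ≤ w.symm (w' x) ∧ w.symm (w' x) ≤ n := by
    intro x a b
    have c := isPerm_mem n w' hw' x a b
    exact isPerm_mem n _ (isPerm_symm n w hw) _ c.1 c.2
  obtain ⟨i, hi⟩ : ∃ i, i = w.symm (w' t) := ⟨_, rfl⟩
  obtain ⟨m, hm⟩ : ∃ i, i = w.symm (w' (t + 1)) := ⟨_, rfl⟩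
  obtain ⟨j, hj⟩ : ∃ i, i = w.symm (w' (t + 2)) := ⟨_, rfl⟩
  have wi : w i = w' t := by rw [hi]; simp
  have wm : w m = w' (t + 1) := by rw [hm]; simp
  have wj : w j = w' (t + 2) := by rw [hj]; simp
  have mi := mem t (by omega) (by omega)
  have mj := mem (t + 2) (by omega) (by omega)
  rw [← hi, ← hm] at him
  rw [← hm, ← hj] at hmj
  rw [← hi] at mi
  rw [← hj] at mj
  rw [← wi, ← wm] at d1
  rw [← wm, ← wj] at d2
  have Pi : w'.symm (w i) = t := by rw [wi]; simp
  have Pm : w'.symm (w m) = t + 1 := by rw [wm]; simp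
  have Pj : w'.symm (w j) = t + 2 := by rw [wj]; simp
  have Pinj : Function.Injective fun q => w'.symm (w q) := w'.symm.injective.comp w.injective
  have Pmem : ∀ q, 1 ≤ q → q ≤ n → 1 ≤ w'.symm (w q) ∧ w'.symm (w q) ≤ n := by
    intro q a b
    have := isPerm_mem n w hw q a b
    exact isPerm_mem n _ (isPerm_symm n w' hw') _ this.1 this.2
  have Plt : ∀ q q', q < q' → w q < w q' → w'.symm (w q) < w'.symm (w q') := by
    intro q q' a b
    exact non _ _ b (by simpa using a)
  have Pne : ∀ q q', q ≠ q' → w'.symm (w q) ≠ w'.symm (w q') := fun q q' a b => a (Pinj b)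
  have hU : ((Finset.Icc 1 n).filter fun q => (i < q ∧ w i < w q) ∨ (j < q ∧ w j < w q)).card
      + k + 1 ≤ n := by
    have : (((Finset.Icc 1 n).filter fun q => (i < q ∧ w i < w q) ∨ (j < q ∧ w j < w q)).image
        fun q => w'.symm (w q)) ⊆ Finset.Icc (k + 2) n := by
      intro x hx
      rw [Finset.mem_image] at hx
      obtain ⟨q, hq, rfl⟩ := hx
      rw [Finset.mem_filter, Finset.mem_Icc] at hq
      have a := Pmem q hq.1.1 hq.1.2
      rw [Finset.mem_Icc]
      have b1 := Plt i q
      have b2 := Plt j q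
      have ei : q ≠ i := by rintro rfl; omega
      have em : q ≠ m := by rintro rfl; omega
      have ej : q ≠ j := by rintro rfl; omega
      have c1 := Pne q i ei
      have c2 := Pne q m em
      have c3 := Pne q j ej
      omega
    have := Finset.card_le_card this
    rw [Finset.card_image_of_injective _ Pinj, Nat.card_Icc] at this
    omega
  have hD : ((Finset.Icc 1 n).filter fun q => (q < i ∧ w q < w i) ∨ (q < j ∧ w q < w j)).card
      + 1 ≤ k := by
    have : (((Finset.Icc 1 n).filter fun q => (q < i ∧ w q < w i) ∨ (q < j ∧ w q < w j)).image
        fun q => w'.symm (w q)) ⊆ Finset.Icc 1 (k - 1) := by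
      intro x hx
      rw [Finset.mem_image] at hx
      obtain ⟨q, hq, rfl⟩ := hx
      rw [Finset.mem_filter, Finset.mem_Icc] at hq
      have a := Pmem q hq.1.1 hq.1.2
      rw [Finset.mem_Icc]
      have b1 := Plt q i
      have b2 := Plt q j
      have ei : q ≠ i := by rintro rfl; omega
      have em : q ≠ m := by rintro rfl; omega
      have ej : q ≠ j := by rintro rfl; omega
      have c1 := Pne q i ei
      have c2 := Pne q m em
      have c3 := Pne q j ej
      omega
    have := Finset.card_le_card this
    rw [Finset.card_image_of_injective _ Pinj, Nat.card_Icc] at this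
    omega
  by_cases c1 : j ≤ k
  · exact leftCase n k w w.injective i m j mi.1 c1 (by omega) him hmj d2 d1 hU
  · by_cases c2 : k < i
    · exact rightCase n k w w.injective i m j c2 mj.2 him hmj d2 d1 hD
    · exact straddle n k w w.injective i m j mi.1 (by omega) (by omega) mj.2 him hmj d2 d1 hU hD

/-- Theorem: fixed repetition. `max_k(w) > min_k(w)` if and only if
there is a `321`-pattern in `w` straddling position `k`, with positions `i < m < j`,
`i ≤ k < j`, such that `L_w := {w(q) > w(i) : i < q ≤ k}` and
`R_w := {w(q) < w(j) : k < q < j}` have equal cardinality and each appears in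
increasing order from left to right in `w`. -/
theorem maxOcc_gt_minOcc_iff (n : ℕ) (hn : 2 ≤ n) (w : Equiv.Perm ℕ)
    (hw : IsPermOf n w) (k : ℕ) (hk1 : 1 ≤ k) (hk2 : k ≤ n - 1) :
    minOcc n k w < maxOcc n k w ↔
      ∃ i m j, Is321At n w i m j ∧ i ≤ k ∧ k < j ∧
        ((Finset.Ioc i k).filter fun q => w i < w q).card =
          ((Finset.Ioo k j).filter fun q => w q < w j).card ∧
        (∀ q1 ∈ (Finset.Ioc i k).filter fun q => w i < w q,
          ∀ q2 ∈ (Finset.Ioc i k).filter fun q => w i < w q,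
            q1 < q2 → w q1 < w q2) ∧
        (∀ q1 ∈ (Finset.Ioo k j).filter fun q => w q < w j,
          ∀ q2 ∈ (Finset.Ioo k j).filter fun q => w q < w j,
            q1 < q2 → w q1 < w q2) := by
  rw [min_lt_max_iff n k w hw]
  constructor
  · intro h
    obtain ⟨i, m, j, l, h1, him, hmj, hjn, w1, w2, hik, hkj, hL, hR⟩ :=
      forward n k w hw hk1 (by omega) h
    exact ⟨i, m, j, ⟨h1, him, hmj, hjn, w1, w2⟩, hik, hkj, by rw [hL.1, hR.1], hL.2, hR.2⟩
  · rintro ⟨i, m, j, ⟨h1, him, hmj, hjn, w1, w2⟩, hik, hkj, hc, hL, hR⟩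
    exact backward n k w hw ⟨i, m, j, _, h1, him, hmj, hjn, w1, w2, hik, hkj, ⟨hc, hL⟩, ⟨rfl, hR⟩⟩
end
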